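/- For every δ ∈ (0,1) there exists a constant C_δ (one may take C_δ = exp(c/δ) for a universal constant c > 0) such that the following holds. Let G = (V,E) be a graph on n vertices with maximum degree Δ ≥ 3, let β satisfy (Δ−2+δ)/(Δ−δ) ≤ β ≤ (Δ−δ)/(Δ−2+δ), and let λ ∈ ℝ_{>0}^V be arbitrary local fields. Let μ be the Gibbs distribution of the Ising model (G, β, λ), and write λ_max = max_v λ_v, λ_min = min_v λ_v. Then for every ε ∈ (0,1), the mixing time of the Glauber dynamics on μ satisfies T_mix(ε) ≤ C_δ · (λ_max/λ_min) · n · (log(n/ε) + log log(2λ_max/λ_min)). -/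

import Mathlib

open Classical Finset

noncomputable section

namespace PaperIsing

/-- A configuration assigns to each vertex a spin; `true` encodes `+1`, `false` encodes `-1`. -/
abbrev Conf (V : Type*) := V → Bool

variable {V : Type*} [Fintype V] [DecidableEq V]

/-- `μ` is a probability distribution on the finite type `A`. -/
def IsDist {A : Type*} [Fintype A] (μ : A → ℝ) : Prop :=
  (∀ a, 0 ≤ μ a) ∧ ∑ a, μ a = 1

/-- Entropy functional `Ent_μ[f] = E_μ[f log f] − E_μ[f] log E_μ[f]`
(the convention `0 log 0 = 0` holds since `Real.log 0 = 0`). -/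
def entOf {A : Type*} [Fintype A] (μ f : A → ℝ) : ℝ :=
  (∑ a, μ a * (f a * Real.log (f a))) - (∑ a, μ a * f a) * Real.log (∑ a, μ a * f a)

/-- KL divergence `KL(ν‖μ)`. -/
def klDivF {A : Type*} [Fintype A] (ν μ : A → ℝ) : ℝ :=
  ∑ a, ν a * Real.log (ν a / μ a)

/-- The covariance of `f` and `log f` with respect to `ν`. -/
def ment {A : Type*} [Fintype A] (ν f : A → ℝ) : ℝ :=
  (1/2) * ∑ σ : A, ∑ τ : A, ν σ * ν τ * (f σ - f τ) * (Real.log (f σ) - Real.log (f τ))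

/-- Total variation distance between two distributions on a finite type. -/
def tvDist {A : Type*} [Fintype A] (p q : A → ℝ) : ℝ :=
  (1/2) * ∑ a, |p a - q a|

/-- The set of `+1` vertices of a configuration. -/
def plusSet (σ : Conf V) : Finset V := Finset.univ.filter (fun v => σ v = true)

/-- `‖σ‖₊`, the number of `+1` spins. -/
def plusCount (σ : Conf V) : ℕ := (plusSet σ).card

/-- Marginal probability, under `μ`, that the configuration agrees with `τ` on `Λ`. -/
def margin (μ : Conf V → ℝ) (Λ : Finset V) (τ : Conf V) : ℝ :=
  ∑ σ : Conf V, if ∀ v ∈ Λ, σ v = τ v then μ σ else 0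

/-- `μ` conditioned on agreeing with `τ` on `Λ`. -/
def condDist (μ : Conf V → ℝ) (Λ : Finset V) (τ : Conf V) : Conf V → ℝ :=
  fun σ => if ∀ v ∈ Λ, σ v = τ v then μ σ / margin μ Λ τ else 0

/-- Transition matrix of the Glauber dynamics for `μ`:
pick `v` uniformly, resample the spin at `v` from the conditional marginal. -/
def glauber (μ : Conf V → ℝ) (σ τ : Conf V) : ℝ :=
  (Fintype.card V : ℝ)⁻¹ * ∑ v : V, condDist μ (Finset.univ.erase v) σ τ

/-- Dirichlet form `E_P(f, log f) = ⟨f, (I−P) log f⟩_μ` for the Glauber dynamics `P` on `μ`. -/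
def dirichletLog (μ f : Conf V → ℝ) : ℝ :=
  ∑ σ : Conf V, μ σ * f σ * (Real.log (f σ) - ∑ τ : Conf V, glauber μ σ τ * Real.log (f τ))

/-- Modified log-Sobolev constant of the Glauber dynamics on `μ`. -/
def mlsConst (μ : Conf V → ℝ) : ℝ :=
  sInf {r : ℝ | ∃ f : Conf V → ℝ, (∀ σ, 0 ≤ f σ) ∧ entOf μ f ≠ 0 ∧
    r = dirichletLog μ f / entOf μ f}

/-- Modified log-Sobolev constant under the worst pinning. -/
def mlsMin (μ : Conf V → ℝ) : ℝ :=
  sInf {r : ℝ | ∃ (Λ : Finset V) (τ : Conf V), 0 < margin μ Λ τ ∧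
    r = mlsConst (condDist μ Λ τ)}

/-- Imposing local fields `lam` on `μ`: `μ^(λ)(σ) ∝ μ(σ) ∏_{v : σ_v = +1} λ_v`. -/
def magnetize (μ : Conf V → ℝ) (lam : V → ℝ) : Conf V → ℝ :=
  fun σ => (μ σ * ∏ v : V, if σ v then lam v else 1) /
    (∑ τ : Conf V, μ τ * ∏ v : V, if τ v then lam v else 1)

/-- Imposing the constant local field `θ`. -/
def magnetizeC (μ : Conf V → ℝ) (θ : ℝ) : Conf V → ℝ :=
  magnetize μ (fun _ => θ)

/-- `Z_π = ∑_σ μ(σ) θ^{‖σ‖₊}`. -/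
def Zmag (μ : Conf V → ℝ) (θ : ℝ) : ℝ :=
  ∑ σ : Conf V, μ σ * θ ^ plusCount σ

/-- `Pr_μ[σ_v = +1 ∣ σ_u = b]`. -/
def condPlusProb (μ : Conf V → ℝ) (u : V) (b : Bool) (v : V) : ℝ :=
  (∑ σ : Conf V, if σ u = b ∧ σ v = true then μ σ else 0) /
  (∑ σ : Conf V, if σ u = b then μ σ else 0)

/-- Signed influence matrix `Ψ^inf_μ(u,v)`. -/
def infl (μ : Conf V → ℝ) (u v : V) : ℝ :=
  if u ≠ v ∧ 0 < (∑ σ : Conf V, if σ u = true then μ σ else 0) ∧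
      0 < (∑ σ : Conf V, if σ u = false then μ σ else 0)
  then condPlusProb μ u true v - condPlusProb μ u false v
  else 0

/-- `μ` is `η`-spectrally independent in `∞`-norm. -/
def SIinf (μ : Conf V → ℝ) (η : ℝ) : Prop :=
  ∀ u : V, ∑ v : V, |infl μ u v| ≤ η

/-- `μ` is `η`-spectrally independent in `∞`-norm with all fields. -/
def SIinfAllFields (μ : Conf V → ℝ) (η : ℝ) : Prop :=
  ∀ lam : V → ℝ, (∀ v, 0 < lam v) → SIinf (magnetize μ lam) η

/-- The projection `σ ↦ σ*` from configurations on `V × [k]` to configurations on `V`. -/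
def kstar {k : ℕ} (τ : Conf (V × Fin k)) : Conf V :=
  fun v => decide (∃ i : Fin k, τ (v, i) = true)

/-- The `k`-transformation `μ_k = Trans(μ, k)` of `μ`. -/
def ktrans (μ : Conf V → ℝ) (k : ℕ) : Conf (V × Fin k) → ℝ :=
  fun τ =>
    if ∀ v : V, (Finset.univ.filter (fun i : Fin k => τ (v, i) = true)).card ≤ 1
    then μ (kstar τ) * ((k : ℝ)⁻¹) ^ plusCount (kstar τ)
    else 0

/-- Probability of the subset `R` under `Bin(V, 1−θ)`. -/
def binWeight (θ : ℝ) (R : Finset V) : ℝ :=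
  (1 - θ) ^ R.card * θ ^ (Fintype.card V - R.card)

/-- The term `π_R(𝟙_R) ⬝ Ent_{π^{𝟙_R}}[f]` with `π = μ^(θ)`
(when `π_R(𝟙_R) = 0` this product is `0`, matching the convention). -/
def mbfTerm (μ : Conf V → ℝ) (θ : ℝ) (f : Conf V → ℝ) (R : Finset V) : ℝ :=
  margin (magnetizeC μ θ) R (fun _ => true) *
    entOf (condDist (magnetizeC μ θ) R (fun _ => true)) f

/-- `θ`-magnetized block factorization of entropy with parameter `C`. -/
def MBF (μ : Conf V → ℝ) (θ C : ℝ) : Prop :=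
  ∀ f : Conf V → ℝ, (∀ σ, 0 ≤ f σ) →
    entOf μ f ≤ C * (Zmag μ θ / θ ^ (Fintype.card V)) *
      ∑ R : Finset V, binWeight θ R * mbfTerm μ θ f R

/-- `ν[Ent_S[f]] = ∑_{σ ∈ Ω(ν_{W∖S})} ν_{W∖S}(σ) Ent_{ν^σ}[f]`, with canonical
representatives `χ` vanishing on `S`. -/
def avgEnt {W : Type*} [Fintype W] [DecidableEq W]
    (ν : Conf W → ℝ) (S : Finset W) (f : Conf W → ℝ) : ℝ :=
  ∑ χ : Conf W, if ∀ v ∈ S, χ v = false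
    then margin ν (Finset.univ \ S) χ * entOf (condDist ν (Finset.univ \ S) χ) f
    else 0

/-- `ℓ`-uniform block factorization of entropy with parameter `C`. -/
def UBF {W : Type*} [Fintype W] [DecidableEq W]
    (ν : Conf W → ℝ) (ℓ : ℕ) (C : ℝ) : Prop :=
  ∀ f : Conf W → ℝ, (∀ σ, 0 ≤ f σ) →
    entOf ν f ≤ (C / (Nat.choose (Fintype.card W) ℓ : ℝ)) *
      ∑ S ∈ Finset.powersetCard ℓ (Finset.univ : Finset W), avgEnt ν S f

/-- The down walk applied to a distribution: `(ν D_{k→j})(β) = Σ_{α ⊇ β} ν(α)/C(k,j)`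
for `|β| = j`. -/
def downDist {U : Type*} [Fintype U] [DecidableEq U]
    (ν : Finset U → ℝ) (k j : ℕ) : Finset U → ℝ :=
  fun β => if β.card = j
    then (∑ α : Finset U, if β ⊆ α ∧ α.card = k then ν α else 0) / (Nat.choose k j : ℝ)
    else 0

/-- The up walk applied to a function:
`(U_{j→k} f)(α) = (Σ_{β ⊇ α} μ(β) f(β)) / (Σ_{γ ⊇ α} μ(γ))` for `μ` supported on size-`k` sets. -/
def upFun {U : Type*} [Fintype U] [DecidableEq U]
    (μ f : Finset U → ℝ) : Finset U → ℝ :=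
  fun α => (∑ β : Finset U, if α ⊆ β then μ β * f β else 0) /
    (∑ γ : Finset U, if α ⊆ γ then μ γ else 0)

/-- The multivariate hypergeometric distribution `HG(V, k, ℓ)`. -/
def hyperGeo (V : Type*) [Fintype V] (k ℓ : ℕ) (a : V → ℕ) : ℝ :=
  if ∑ v, a v = ℓ
  then (∏ v, (Nat.choose k (a v) : ℝ)) / (Nat.choose (k * Fintype.card V) ℓ : ℝ)
  else 0

/-- The flipped distribution `flip(μ, χ)(σ) = μ(σ ⊙ χ)`, where `(σ ⊙ χ)_v = σ_v χ_v`. -/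
def flipDist (μ : Conf V → ℝ) (χ : Conf V) : Conf V → ℝ :=
  fun σ => μ (fun v => σ v == χ v)

/-- The number of monochromatic edges of `G` under `σ`. -/
def monoCount (G : SimpleGraph V) (σ : Conf V) : ℕ :=
  (Finset.univ.filter (fun e : Sym2 V =>
    e ∈ G.edgeSet ∧ ∀ a ∈ e, ∀ b ∈ e, σ a = σ b)).card

/-- The Gibbs distribution of the Ising model `(G, β, λ)`. -/
def isingGibbs (G : SimpleGraph V) (β : ℝ) (lam : V → ℝ) : Conf V → ℝ :=
  fun σ => (β ^ monoCount G σ * ∏ v : V, if σ v then lam v else 1) /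
    (∑ τ : Conf V, β ^ monoCount G τ * ∏ v : V, if τ v then lam v else 1)

/-- Distribution of the Glauber dynamics on `μ` after `t` steps, started from initial
distribution `ν`. -/
def chainDist (μ ν : Conf V → ℝ) : ℕ → Conf V → ℝ
  | 0 => ν
  | (t+1) => fun τ => ∑ σ : Conf V, chainDist μ ν t σ * glauber μ σ τ

/-- `‖Ψ^inf_μ‖_∞ = max_u Σ_v |Ψ^inf_μ(u,v)|`. -/
def psiNorm [Nonempty V] (μ : Conf V → ℝ) : ℝ :=
  Finset.univ.sup' Finset.univ_nonempty (fun u => ∑ v : V, |infl μ u v|)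

end PaperIsing

open PaperIsing

set_option linter.unusedSectionVars false
namespace IsingAux

/-- log-sum inequality -/
theorem log_sum {ι : Type*} (s : Finset ι) (a b : ι → ℝ) (ha : ∀ i ∈ s, 0 < a i)
    (hb : ∀ i ∈ s, 0 < b i) :
    (∑ i ∈ s, a i) * Real.log ((∑ i ∈ s, a i) / ∑ i ∈ s, b i) ≤
      ∑ i ∈ s, a i * Real.log (a i / b i) := by
  rcases s.eq_empty_or_nonempty with rfl | hs
  · simp
  set A := ∑ i ∈ s, a i with hA
  set B := ∑ i ∈ s, b i with hB
  have hA0 : 0 < A := Finset.sum_pos ha hs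
  have hB0 : 0 < B := Finset.sum_pos hb hs
  have key : ∀ i ∈ s, a i * Real.log (A / B) + (a i - b i * (A / B)) ≤
      a i * Real.log (a i / b i) := by
    intro i hi
    have h1 := ha i hi
    have h2 := hb i hi
    have h3 : 0 < (a i / b i) / (A / B) := by positivity
    have h4 := Real.one_sub_inv_le_log_of_pos h3
    rw [Real.log_div (by positivity) (by positivity)] at h4
    have h5 : ((a i / b i) / (A / B))⁻¹ = b i * (A / B) / a i := by
      field_simp
    rw [h5] at h4
    have h6 := mul_le_mul_of_nonneg_left h4 h1.le
    have h7 : a i * (1 - b i * (A / B) / a i) = a i - b i * (A / B) := by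
      field_simp
    rw [h7] at h6
    linarith
  have h := Finset.sum_le_sum key
  rw [Finset.sum_add_distrib, Finset.sum_sub_distrib, ← Finset.sum_mul, ← Finset.sum_mul,
    ← hA, ← hB] at h
  have : B * (A / B) = A := by field_simp
  rw [this] at h
  linarith

def Lf {X : Type*} [Fintype X] (g w : X → ℝ) : ℝ :=
  ∑ σ, g σ * Real.log (g σ / w σ) - (∑ σ, g σ) * Real.log ((∑ σ, g σ) / ∑ σ, w σ)

theorem Lf_nonneg {X : Type*} [Fintype X] (g w : X → ℝ) (hg : ∀ σ, 0 < g σ)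
    (hw : ∀ σ, 0 < w σ) : 0 ≤ Lf g w := by
  have := log_sum Finset.univ g w (fun i _ => hg i) (fun i _ => hw i)
  unfold Lf; linarith

theorem Lf_smul_left {X : Type*} [Fintype X] [Nonempty X] (g w : X → ℝ) (hg : ∀ σ, 0 < g σ)
    (hw : ∀ σ, 0 < w σ) (c : ℝ) (hc : 0 < c) : Lf (fun σ => c * g σ) w = c * Lf g w := by
  unfold Lf
  have hG : 0 < ∑ σ, g σ := Finset.sum_pos (fun i _ => hg i) Finset.univ_nonempty
  have hW : 0 < ∑ σ, w σ := Finset.sum_pos (fun i _ => hw i) Finset.univ_nonempty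
  have h1 : ∀ σ, c * g σ * Real.log (c * g σ / w σ) =
      c * (g σ * Real.log (g σ / w σ)) + c * Real.log c * g σ := by
    intro σ
    rw [mul_div_assoc, Real.log_mul hc.ne' (div_pos (hg σ) (hw σ)).ne']; ring
  simp only [h1]
  rw [Finset.sum_add_distrib, ← Finset.mul_sum, ← Finset.mul_sum, ← Finset.mul_sum,
    mul_div_assoc, Real.log_mul hc.ne' (div_pos hG hW).ne']
  ring

theorem Lf_smul_right {X : Type*} [Fintype X] [Nonempty X] (g w : X → ℝ) (hg : ∀ σ, 0 < g σ)
    (hw : ∀ σ, 0 < w σ) (c : ℝ) (hc : 0 < c) : Lf g (fun σ => c * w σ) = Lf g w := by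
  unfold Lf
  have hG : 0 < ∑ σ, g σ := Finset.sum_pos (fun i _ => hg i) Finset.univ_nonempty
  have hW : 0 < ∑ σ, w σ := Finset.sum_pos (fun i _ => hw i) Finset.univ_nonempty
  have h1 : ∀ σ, g σ * Real.log (g σ / (c * w σ)) =
      (g σ * Real.log (g σ / w σ)) - Real.log c * g σ := by
    intro σ
    rw [mul_comm c, ← div_div, Real.log_div (div_pos (hg σ) (hw σ)).ne' hc.ne']; ring
  simp only [h1]
  rw [Finset.sum_sub_distrib, ← Finset.mul_sum, ← Finset.mul_sum, 
    mul_comm c, ← div_div, Real.log_div (div_pos hG hW).ne' hc.ne']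
  ring

variable {V : Type} [Fintype V] [DecidableEq V]

def Sv (v : V) (g : Conf V → ℝ) (σ : Conf V) : ℝ :=
  g (Function.update σ v true) + g (Function.update σ v false)

theorem Sv_pos (v : V) (g : Conf V → ℝ) (hg : ∀ σ, 0 < g σ) (σ : Conf V) : 0 < Sv v g σ :=
  add_pos (hg _) (hg _)

theorem Sv_update (v : V) (g : Conf V → ℝ) (σ : Conf V) (b : Bool) :
    Sv v g (Function.update σ v b) = Sv v g σ := by
  simp [Sv]

theorem Sv_mul (v : V) (g φ : Conf V → ℝ) (hφ : ∀ σ b, φ (Function.update σ v b) = φ σ)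
    (σ : Conf V) : Sv v (fun σ => g σ * φ σ) σ = Sv v g σ * φ σ := by
  simp [Sv, hφ, add_mul]

theorem sum_Sv (v : V) (g : Conf V → ℝ) : ∑ σ, Sv v g σ = 2 * ∑ σ, g σ := by
  let e : Conf V ≃ Conf V := 
    { toFun := fun σ => Function.update σ v (!σ v)
      invFun := fun σ => Function.update σ v (!σ v)
      left_inv := fun σ => by simp
      right_inv := fun σ => by simp }
  have h : ∀ σ, Sv v g σ = g σ + g (e σ) := by
    intro σ
    have hσ : Function.update σ v (σ v) = σ := Function.update_eq_self v σ
    change _ = g σ + g (Function.update σ v (!σ v))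
    unfold Sv
    cases hb : σ v
    · rw [hb] at hσ; rw [hσ]; simp [add_comm]
    · rw [hb] at hσ; rw [hσ]; simp
  simp only [h]
  rw [Finset.sum_add_distrib, Equiv.sum_comp e g]; ring

def Dv (v : V) (g w : Conf V → ℝ) : ℝ :=
  ∑ σ, g σ * Real.log (g σ / w σ) - (1/2) * ∑ σ, Sv v g σ * Real.log (Sv v g σ / Sv v w σ)

theorem Dv_eq (v : V) (g w : Conf V → ℝ) (hg : ∀ σ, 0 < g σ) (hw : ∀ σ, 0 < w σ) :
    Dv v g w = ∑ σ, g σ * Real.log (g σ * Sv v w σ / (w σ * Sv v g σ)) := by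
  have h2 : ∑ σ, Sv v g σ * Real.log (Sv v g σ / Sv v w σ) =
      2 * ∑ σ, g σ * Real.log (Sv v g σ / Sv v w σ) := by
    rw [← sum_Sv v (fun σ => g σ * Real.log (Sv v g σ / Sv v w σ))]
    refine Finset.sum_congr rfl fun σ _ => ?_
    rw [Sv_mul v g (fun σ => Real.log (Sv v g σ / Sv v w σ)) (fun σ b => by simp [Sv_update])]
  unfold Dv
  rw [h2, ← mul_assoc, show (1/2 : ℝ) * 2 = 1 by norm_num, one_mul, ← Finset.sum_sub_distrib]
  refine Finset.sum_congr rfl fun σ _ => ?_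
  rw [← mul_sub, ← Real.log_div (div_pos (hg σ) (hw σ)).ne'
    (div_pos (Sv_pos v g hg σ) (Sv_pos v w hw σ)).ne']
  congr 2
  have := (hw σ).ne'
  have := (Sv_pos v g hg σ).ne'
  have := (Sv_pos v w hw σ).ne'
  field_simp

theorem Dv_smul_right (v : V) (g w : Conf V → ℝ) (hg : ∀ σ, 0 < g σ)
    (hw : ∀ σ, 0 < w σ) (c : ℝ) (hc : 0 < c) : Dv v g (fun σ => c * w σ) = Dv v g w := by
  rw [Dv_eq v _ _ hg hw, Dv_eq v _ _ hg (fun σ => mul_pos hc (hw σ))]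
  refine Finset.sum_congr rfl fun σ _ => ?_
  congr 2
  have h1 := (hw σ).ne'
  have h2 := (Sv_pos v g hg σ).ne'
  unfold Sv at *
  field_simp

theorem Dv_smul_left (v : V) (g w : Conf V → ℝ) (hg : ∀ σ, 0 < g σ)
    (hw : ∀ σ, 0 < w σ) (c : ℝ) (hc : 0 < c) : Dv v (fun σ => c * g σ) w = c * Dv v g w := by
  rw [Dv_eq v _ _ hg hw, Dv_eq v _ _ (fun σ => mul_pos hc (hg σ)) hw, Finset.mul_sum]
  refine Finset.sum_congr rfl fun σ _ => ?_
  rw [mul_assoc c]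
  congr 3
  have h1 := (hw σ).ne'
  have h2 := (Sv_pos v g hg σ).ne'
  unfold Sv at *
  field_simp

def AT (w : Conf V → ℝ) (C : ℝ) : Prop :=
  ∀ g : Conf V → ℝ, (∀ σ, 0 < g σ) → Lf g w ≤ C * ∑ v, Dv v g w

theorem AT_smul (w : Conf V → ℝ) (hw : ∀ σ, 0 < w σ) (C c : ℝ) (hc : 0 < c) (h : AT w C) :
    AT (fun σ => c * w σ) C := by
  intro g hg
  rw [Lf_smul_right g w hg hw c hc]
  simp only [Dv_smul_right _ g w hg hw c hc]
  exact h g hg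

/-- resampling operator on measures -/
def Tv (v : V) (w g : Conf V → ℝ) (σ : Conf V) : ℝ := w σ * (Sv v g σ / Sv v w σ)

theorem Tv_pos (v : V) (g w : Conf V → ℝ) (hg : ∀ σ, 0 < g σ) (hw : ∀ σ, 0 < w σ) (σ : Conf V) :
    0 < Tv v w g σ := mul_pos (hw σ) (div_pos (Sv_pos v g hg σ) (Sv_pos v w hw σ))

theorem sum_Tv_mul (v : V) (g w φ : Conf V → ℝ) (hw : ∀ σ, 0 < w σ)
    (hφ : ∀ σ b, φ (Function.update σ v b) = φ σ) :
    ∑ σ, Tv v w g σ * φ σ = ∑ σ, g σ * φ σ := by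
  have h1 := sum_Sv v (fun σ => Tv v w g σ * φ σ)
  have h2 := sum_Sv v (fun σ => g σ * φ σ)
  have : ∀ σ, Sv v (fun σ => Tv v w g σ * φ σ) σ = Sv v (fun σ => g σ * φ σ) σ := by
    intro σ
    have h3 := (Sv_pos v w hw σ).ne'
    conv_lhs => unfold Sv
    conv_rhs => unfold Sv
    simp only [Tv, Sv_update, hφ]
    unfold Sv at *
    field_simp
  simp only [this] at h1
  linarith

theorem sum_Tv (v : V) (g w : Conf V → ℝ) (hw : ∀ σ, 0 < w σ) :
    ∑ σ, Tv v w g σ = ∑ σ, g σ := by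
  simpa using sum_Tv_mul v g w (fun _ => 1) hw (fun _ _ => rfl)

theorem Lf_Tv (v : V) (g w : Conf V → ℝ) (hw : ∀ σ, 0 < w σ) :
    Lf (Tv v w g) w = Lf g w - Dv v g w := by
  unfold Lf Dv
  rw [sum_Tv v g w hw]
  have h1 : ∑ σ, Tv v w g σ * Real.log (Tv v w g σ / w σ) =
      ∑ σ, Tv v w g σ * Real.log (Sv v g σ / Sv v w σ) := by
    refine Finset.sum_congr rfl fun σ _ => ?_
    congr 2
    have := (hw σ).ne'
    unfold Tv; field_simp
  have h2 : ∑ σ, Tv v w g σ * Real.log (Sv v g σ / Sv v w σ) =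
      ∑ σ, g σ * Real.log (Sv v g σ / Sv v w σ) :=
    sum_Tv_mul v g w _ hw (fun σ b => by simp [Sv_update])
  have h3 : ∑ σ, Sv v g σ * Real.log (Sv v g σ / Sv v w σ) =
      2 * ∑ σ, g σ * Real.log (Sv v g σ / Sv v w σ) := by
    rw [← sum_Sv v (fun σ => g σ * Real.log (Sv v g σ / Sv v w σ))]
    refine Finset.sum_congr rfl fun σ _ => ?_
    rw [Sv_mul v g (fun σ => Real.log (Sv v g σ / Sv v w σ)) (fun σ b => by simp [Sv_update])]
  rw [h1, h2, h3]; ring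

end IsingAux

namespace IsingAux
variable {V : Type} [Fintype V] [DecidableEq V]

def Er (q : V → Bool → ℝ) (v : V) (r : Conf V → ℝ) (σ : Conf V) : ℝ :=
  q v true * r (Function.update σ v true) + q v false * r (Function.update σ v false)

theorem Er_eq (w : Conf V → ℝ) (hw : ∀ σ, 0 < w σ) (q : V → Bool → ℝ)
    (hwq : ∀ v σ, w σ = q v (σ v) * Sv v w σ) (v : V) (r : Conf V → ℝ) (σ : Conf V) :
    Sv v (fun σ => r σ * w σ) σ / Sv v w σ = Er q v r σ := by
  have h1 := hwq v (Function.update σ v true)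
  have h2 := hwq v (Function.update σ v false)
  simp only [Sv_update, Function.update_self] at h1 h2
  have h3 := (Sv_pos v w hw σ).ne'
  rw [div_eq_iff h3]
  conv_lhs => unfold Sv
  beta_reduce
  rw [h1, h2]
  unfold Er; ring

theorem Er_pos (q : V → Bool → ℝ) (hq : ∀ v b, 0 < q v b) (v : V) (r : Conf V → ℝ)
    (hr : ∀ σ, 0 < r σ) (σ : Conf V) : 0 < Er q v r σ :=
  add_pos (mul_pos (hq _ _) (hr _)) (mul_pos (hq _ _) (hr _))

theorem sum_Er (w : Conf V → ℝ) (hw : ∀ σ, 0 < w σ) (q : V → Bool → ℝ)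
    (hwq : ∀ v σ, w σ = q v (σ v) * Sv v w σ) (v : V) (r : Conf V → ℝ) :
    ∑ σ, w σ * Er q v r σ = ∑ σ, w σ * r σ := by
  have := sum_Tv v (fun σ => r σ * w σ) w hw
  unfold Tv at this
  simp only [Er_eq w hw q hwq] at this
  rw [this]
  exact Finset.sum_congr rfl fun _ _ => mul_comm _ _

theorem Dv_prod (w : Conf V → ℝ) (hw : ∀ σ, 0 < w σ) (q : V → Bool → ℝ) (hq : ∀ v b, 0 < q v b)
    (hwq : ∀ v σ, w σ = q v (σ v) * Sv v w σ) (v : V) (r : Conf V → ℝ) (hr : ∀ σ, 0 < r σ) :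
    Dv v (fun σ => r σ * w σ) w = ∑ σ, w σ * (r σ * Real.log (r σ / Er q v r σ)) := by
  rw [Dv_eq v _ _ (fun σ => mul_pos (hr σ) (hw σ)) hw]
  refine Finset.sum_congr rfl fun σ _ => ?_
  rw [← Er_eq w hw q hwq]
  rw [mul_comm (r σ) (w σ), mul_assoc (w σ)]
  congr 3
  have h1 := (hw σ).ne'
  have h2 := (Sv_pos v w hw σ).ne'
  have h3 := (Sv_pos v (fun σ => r σ * w σ) (fun σ => mul_pos (hr σ) (hw σ)) σ).ne'
  field_simp

theorem Dv_prod_mono (w : Conf V → ℝ) (hw : ∀ σ, 0 < w σ) (q : V → Bool → ℝ)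
    (hq : ∀ v b, 0 < q v b)
    (hwq : ∀ v σ, w σ = q v (σ v) * Sv v w σ) (u v : V) (huv : u ≠ v)
    (r : Conf V → ℝ) (hr : ∀ σ, 0 < r σ) :
    Dv v (fun σ => Er q u r σ * w σ) w ≤ Dv v (fun σ => r σ * w σ) w := by
  rw [Dv_prod w hw q hq hwq v _ (Er_pos q hq u r hr), Dv_prod w hw q hq hwq v _ hr,
    ← sum_Er w hw q hwq u (fun σ => r σ * Real.log (r σ / Er q v r σ))]
  refine Finset.sum_le_sum fun σ _ => mul_le_mul_of_nonneg_left ?_ (hw σ).le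
  have h := log_sum (Finset.univ : Finset Bool) (fun s => q u s * r (Function.update σ u s))
    (fun s => q u s * Er q v r (Function.update σ u s))
    (fun s _ => mul_pos (hq _ _) (hr _)) (fun s _ => mul_pos (hq _ _) (Er_pos q hq v r hr _))
  have h2 : ∀ s, (q u s * r (Function.update σ u s)) / (q u s * Er q v r (Function.update σ u s))
      = r (Function.update σ u s) / Er q v r (Function.update σ u s) := fun s =>
    mul_div_mul_left _ _ (hq u s).ne'
  simp only [h2, Fintype.sum_bool] at h
  have h3 : Er q v (Er q u r) σ = q u true * Er q v r (Function.update σ u true) +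
      q u false * Er q v r (Function.update σ u false) := by
    unfold Er
    simp only [Function.update_comm huv]
    ring
  rw [h3]
  refine le_trans (le_of_eq ?_) (le_trans h (le_of_eq ?_))
  · rfl
  · conv_rhs => unfold Er
    simp only [Er]; ring

theorem AT_prod [Nonempty V] (w : Conf V → ℝ) (hw : ∀ σ, 0 < w σ) (q : V → Bool → ℝ)
    (hq : ∀ v b, 0 < q v b)
    (hwq : ∀ v σ, w σ = q v (σ v) * Sv v w σ) : AT w 1 := by
  intro g hg
  have key : ∀ A : Finset V, ∃ r : Conf V → ℝ, (∀ σ, 0 < r σ) ∧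
      (∀ σ τ, (∀ v, v ∉ A → σ v = τ v) → r σ = r τ) ∧
      (∀ v, v ∉ A → Dv v (fun σ => r σ * w σ) w ≤ Dv v g w) ∧
      Lf g w ≤ ∑ v ∈ A, Dv v g w + Lf (fun σ => r σ * w σ) w := by
    intro A
    induction A using Finset.induction_on with
    | empty =>
      have hr : (fun σ => g σ / w σ * w σ) = g := by
        funext σ; exact div_mul_cancel₀ _ (hw σ).ne'
      refine ⟨fun σ => g σ / w σ, fun σ => div_pos (hg σ) (hw σ), ?_, ?_, ?_⟩
      · intro σ τ h
        rw [funext fun v => h v (by simp)]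
      · intro v _; rw [hr]
      · rw [hr]; simp
    | insert a A ha ih =>
      obtain ⟨r, hr, h1, h2, h3⟩ := ih
      refine ⟨Er q a r, Er_pos q hq a r hr, ?_, ?_, ?_⟩
      · intro σ τ h
        have : ∀ s, r (Function.update σ a s) = r (Function.update τ a s) := by
          intro s
          apply h1
          intro v hv
          by_cases hva : v = a
          · subst hva; simp
          · simp only [Function.update_of_ne hva]
            exact h v (by simp [hva, hv])
        simp only [Er, this]
      · intro v hv
        simp only [Finset.mem_insert, not_or] at hv
        exact (Dv_prod_mono w hw q hq hwq a v (Ne.symm hv.1) r hr).trans (h2 v hv.2)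
      · have h4 := Lf_Tv a (fun σ => r σ * w σ) w hw
        have h5 : Tv a w (fun σ => r σ * w σ) = fun σ => Er q a r σ * w σ := by
          funext σ
          unfold Tv
          rw [Er_eq w hw q hwq, mul_comm]
        rw [h5] at h4
        rw [h4, Finset.sum_insert ha]
        have := h2 a ha
        linarith
  obtain ⟨r, hr, h1, -, h3⟩ := key Finset.univ
  rw [one_mul]
  have hc : r = fun _ => r (fun _ => true) := by
    funext σ; exact h1 _ _ (fun v hv => absurd (Finset.mem_univ v) hv)
  have : Lf (fun σ => r σ * w σ) w = 0 := by
    rw [hc]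
    rw [Lf_smul_left w w hw hw _ (hr _)]
    have hW : 0 < ∑ σ, w σ := Finset.sum_pos (fun i _ => hw i) Finset.univ_nonempty
    unfold Lf
    simp [div_self (hw _).ne', div_self hW.ne']
  linarith

theorem AT_step [Nonempty V] (w : Conf V → ℝ) (hw : ∀ σ, 0 < w σ) {Ξ : Type} [Fintype Ξ]
    (k : Conf V → Ξ → ℝ) (hk : ∀ σ ξ, 0 < k σ ξ) (hk1 : ∀ σ, ∑ ξ, k σ ξ = 1)
    (C x : ℝ) (hC : 0 ≤ C) (hx : x < 1)
    (hat : ∀ ξ, AT (fun σ => w σ * k σ ξ) C)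
    (hinfo : ∀ g : Conf V → ℝ, (∀ σ, 0 < g σ) →
      ∑ ξ, (∑ σ, g σ * k σ ξ) * Real.log ((∑ σ, g σ * k σ ξ) / ∑ σ, w σ * k σ ξ) -
        (∑ σ, g σ) * Real.log ((∑ σ, g σ) / ∑ σ, w σ) ≤ x * Lf g w) :
    AT w (C / (1 - x)) := by
  intro g hg
  have hr : ∀ σ ξ, g σ * k σ ξ / (w σ * k σ ξ) = g σ / w σ := fun σ ξ =>
    mul_div_mul_right _ _ (hk σ ξ).ne'
  have h1 : ∑ ξ, Lf (fun σ => g σ * k σ ξ) (fun σ => w σ * k σ ξ) =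
      ∑ σ, g σ * Real.log (g σ / w σ) - 
      ∑ ξ, (∑ σ, g σ * k σ ξ) * Real.log ((∑ σ, g σ * k σ ξ) / ∑ σ, w σ * k σ ξ) := by
    unfold Lf
    simp only [hr]
    rw [Finset.sum_sub_distrib, Finset.sum_comm]
    congr 1
    refine Finset.sum_congr rfl fun σ _ => ?_
    rw [← Finset.sum_mul, ← Finset.mul_sum, hk1, mul_one]
  have h2 : ∀ v, ∑ ξ, Dv v (fun σ => g σ * k σ ξ) (fun σ => w σ * k σ ξ) ≤ Dv v g w := by
    intro v
    unfold Dv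
    simp only [hr]
    rw [Finset.sum_sub_distrib, Finset.sum_comm]
    have e1 : ∑ σ, ∑ ξ, g σ * k σ ξ * Real.log (g σ / w σ) =
        ∑ σ, g σ * Real.log (g σ / w σ) := by
      refine Finset.sum_congr rfl fun σ _ => ?_
      rw [← Finset.sum_mul, ← Finset.mul_sum, hk1, mul_one]
    rw [e1, ← Finset.mul_sum, Finset.sum_comm]
    have e2 : ∀ (f : Conf V → ℝ) σ, ∑ ξ, Sv v (fun σ => f σ * k σ ξ) σ = Sv v f σ := by
      intro f σ
      unfold Sv
      rw [Finset.sum_add_distrib, ← Finset.mul_sum, ← Finset.mul_sum, hk1, hk1, mul_one, mul_one]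
    have e3 : ∑ σ, Sv v g σ * Real.log (Sv v g σ / Sv v w σ) ≤
        ∑ σ, ∑ ξ, Sv v (fun σ => g σ * k σ ξ) σ * 
          Real.log (Sv v (fun σ => g σ * k σ ξ) σ / Sv v (fun σ => w σ * k σ ξ) σ) := by
      refine Finset.sum_le_sum fun σ _ => ?_
      have := log_sum Finset.univ (fun ξ => Sv v (fun σ => g σ * k σ ξ) σ)
        (fun ξ => Sv v (fun σ => w σ * k σ ξ) σ)
        (fun ξ _ => Sv_pos v _ (fun σ => mul_pos (hg σ) (hk σ ξ)) σ)
        (fun ξ _ => Sv_pos v _ (fun σ => mul_pos (hw σ) (hk σ ξ)) σ)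
      rw [e2, e2] at this
      exact this
    linarith
  have h3 : ∑ ξ, Lf (fun σ => g σ * k σ ξ) (fun σ => w σ * k σ ξ) ≤
      C * ∑ v, Dv v g w := by
    calc _ ≤ ∑ ξ, C * ∑ v, Dv v (fun σ => g σ * k σ ξ) (fun σ => w σ * k σ ξ) :=
          Finset.sum_le_sum fun ξ _ => hat ξ _ (fun σ => mul_pos (hg σ) (hk σ ξ))
      _ = C * ∑ v, ∑ ξ, Dv v (fun σ => g σ * k σ ξ) (fun σ => w σ * k σ ξ) := by
          rw [← Finset.mul_sum, Finset.sum_comm]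
      _ ≤ _ := mul_le_mul_of_nonneg_left (Finset.sum_le_sum fun v _ => h2 v) hC
  have h4 := hinfo g hg
  have h5 : (1 - x) * Lf g w ≤ C * ∑ v, Dv v g w := by
    rw [h1] at h3
    have : Lf g w = ∑ σ, g σ * Real.log (g σ / w σ) -
      (∑ σ, g σ) * Real.log ((∑ σ, g σ) / ∑ σ, w σ) := rfl
    linarith
  rw [div_mul_eq_mul_div, le_div_iff₀ (by linarith)]
  linarith

/-- Pinsker-type inequality -/
theorem pinsker {X : Type*} [Fintype X] (ν μ : X → ℝ) (hν : ∀ σ, 0 < ν σ) (hμ : ∀ σ, 0 < μ σ)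
    (hν1 : ∑ σ, ν σ = 1) (hμ1 : ∑ σ, μ σ = 1) :
    (∑ σ, |ν σ - μ σ|) ^ 2 ≤ 4 * Lf ν μ := by
  have hL : Lf ν μ = ∑ σ, ν σ * Real.log (ν σ / μ σ) := by
    unfold Lf; rw [hν1, hμ1]; simp
  have h1 : ∑ σ, (√(ν σ) - √(μ σ)) ^ 2 ≤ Lf ν μ := by
    have : ∀ σ, (√(ν σ) - √(μ σ)) ^ 2 ≤ ν σ * Real.log (ν σ / μ σ) - ν σ + μ σ := by
      intro σ
      have a := Real.sqrt_pos.2 (hν σ)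
      have b := Real.sqrt_pos.2 (hμ σ)
      have ha := Real.sq_sqrt (hν σ).le
      have hb := Real.sq_sqrt (hμ σ).le
      have hl := Real.one_sub_inv_le_log_of_pos (div_pos a b)
      have hlog : Real.log (ν σ / μ σ) = 2 * Real.log (√(ν σ) / √(μ σ)) := by
        conv_lhs => rw [← ha, ← hb, ← div_pow, Real.log_pow]
        norm_num
      rw [hlog]
      have h2 := mul_le_mul_of_nonneg_left hl (hν σ).le
      have h3 : ν σ * (1 - (√(ν σ) / √(μ σ))⁻¹) = ν σ - √(ν σ) * √(μ σ) := by
        conv_lhs => rw [← ha]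
        conv_rhs => rw [← ha]
        simp only [Real.sqrt_sq a.le]
        field_simp
      nlinarith
    have h2 := Finset.sum_le_sum (fun σ (_ : σ ∈ Finset.univ) => this σ)
    rw [Finset.sum_add_distrib, Finset.sum_sub_distrib, hν1, hμ1] at h2
    linarith
  have h2 : ∀ σ, |ν σ - μ σ| = |√(ν σ) - √(μ σ)| * (√(ν σ) + √(μ σ)) := by
    intro σ
    have ha := Real.sq_sqrt (hν σ).le
    have hb := Real.sq_sqrt (hμ σ).le
    rw [← abs_of_pos (add_pos (Real.sqrt_pos.2 (hν σ)) (Real.sqrt_pos.2 (hμ σ))), ← abs_mul]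
    congr 1
    nlinarith
  simp only [h2]
  refine (Finset.sum_mul_sq_le_sq_mul_sq _ _ _).trans ?_
  simp only [sq_abs]
  have h3 : ∑ σ, (√(ν σ) + √(μ σ)) ^ 2 ≤ 4 := by
    have : ∀ σ, (√(ν σ) + √(μ σ)) ^ 2 ≤ 2 * ν σ + 2 * μ σ := by
      intro σ
      have ha := Real.sq_sqrt (hν σ).le
      have hb := Real.sq_sqrt (hμ σ).le
      nlinarith [sq_nonneg (√(ν σ) - √(μ σ))]
    have h4 := Finset.sum_le_sum (fun σ (_ : σ ∈ Finset.univ) => this σ)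
    rw [Finset.sum_add_distrib, ← Finset.mul_sum, ← Finset.mul_sum, hν1, hμ1] at h4
    linarith
  have h4 : 0 ≤ ∑ σ, (√(ν σ) - √(μ σ)) ^ 2 := Finset.sum_nonneg fun _ _ => sq_nonneg _
  nlinarith

theorem prod_err {I : Type*} (s : Finset I) (y : I → ℝ) (ε : ℝ) (h0 : 0 ≤ ε) (h1 : ε ≤ 1)
    (hy : ∀ i, |y i| ≤ ε) :
    |∏ i ∈ s, (1 + y i) - 1 - ∑ i ∈ s, y i| ≤ ε ^ 2 * 3 ^ s.card ∧ 
    |∑ i ∈ s, y i| ≤ s.card * ε := by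
  induction s using Finset.induction_on with
  | empty => simp; positivity
  | insert a s ha ih =>
    obtain ⟨ih1, ih2⟩ := ih
    rw [Finset.prod_insert ha, Finset.sum_insert ha, Finset.card_insert_of_notMem ha]
    set P := ∏ i ∈ s, (1 + y i)
    set S := ∑ i ∈ s, y i
    have hya := hy a
    refine ⟨?_, ?_⟩
    · have e : (1 + y a) * P - 1 - (y a + S) = (1 + y a) * (P - 1 - S) + y a * S := by ring
      rw [e]
      have c1 : |(1 + y a) * (P - 1 - S)| ≤ 2 * (ε ^ 2 * 3 ^ s.card) := by
        rw [abs_mul]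
        refine mul_le_mul ?_ ih1 (abs_nonneg _) (by norm_num)
        refine (abs_add_le _ _).trans ?_
        simp; linarith
      have c2 : |y a * S| ≤ ε * (s.card * ε) := by
        rw [abs_mul]
        exact mul_le_mul hya ih2 (abs_nonneg _) h0
      have c3 : (s.card : ℝ) ≤ 3 ^ s.card := by
        have := (Nat.lt_pow_self (by norm_num : 1 < 3) (n := s.card)).le
        exact_mod_cast this
      refine (abs_add_le _ _).trans ?_
      have c4 : ε ^ 2 * s.card ≤ ε ^ 2 * 3 ^ s.card := mul_le_mul_of_nonneg_left c3 (sq_nonneg _)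
      rw [pow_succ (3:ℝ)]
      nlinarith
    · refine (abs_add_le _ _).trans ?_
      push_cast
      linarith

def sg : Bool → ℝ
  | true => 1
  | false => -1

theorem sg_sq (b : Bool) : sg b * sg b = 1 := by cases b <;> simp [sg]

theorem sg_abs (b : Bool) : |sg b| = 1 := by cases b <;> simp [sg]

def ker {X I : Type} [Fintype I] (b : I → X → ℝ) (κ : ℝ) (σ : X) (ξ : I → Bool) : ℝ :=
  ∏ i, ((1/2) * (1 + κ * sg (ξ i) * b i σ))

theorem ker_aux {X I : Type} [Fintype I] [DecidableEq I] (b : I → X → ℝ) (κ : ℝ)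
    (h0 : 0 ≤ κ) (hb : ∀ i σ, |b i σ| ≤ 1) (i : I) (σ : X) (s : Bool) :
    1 - κ ≤ 1 + κ * sg s * b i σ := by
  have h : |κ * sg s * b i σ| ≤ κ := by
    rw [abs_mul, abs_mul, sg_abs, abs_of_nonneg h0, mul_one]
    exact mul_le_of_le_one_right h0 (hb i σ)
  have := (abs_le.1 h).1
  linarith

theorem ker_pos {X I : Type} [Fintype I] [DecidableEq I] (b : I → X → ℝ) (κ : ℝ)
    (h0 : 0 ≤ κ) (h1 : κ < 1) (hb : ∀ i σ, |b i σ| ≤ 1) (σ : X) (ξ : I → Bool) :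
    0 < ker b κ σ ξ := by
  unfold ker
  refine Finset.prod_pos fun i _ => ?_
  have := ker_aux b κ h0 hb i σ (ξ i)
  linarith

theorem ker_sum {X I : Type} [Fintype I] [DecidableEq I] (b : I → X → ℝ) (κ : ℝ) (σ : X) :
    ∑ ξ, ker b κ σ ξ = 1 := by
  unfold ker
  rw [← Fintype.prod_sum (fun i s => (1/2) * (1 + κ * sg s * b i σ))]
  refine Finset.prod_eq_one fun i _ => ?_
  simp [sg]; ring

theorem ker_sum2 {X I : Type} [Fintype I] [DecidableEq I] (b : I → X → ℝ) (κ : ℝ) (σ τ : X) :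
    ∑ ξ, ker b κ σ ξ * ker b κ τ ξ = (1/2) ^ Fintype.card I * 
      ∏ i, (1 + κ ^ 2 * b i σ * b i τ) := by
  unfold ker
  simp only [← Finset.prod_mul_distrib]
  rw [← Fintype.prod_sum (fun i s => (1/2) * (1 + κ * sg s * b i σ) *
    ((1/2) * (1 + κ * sg s * b i τ))), Fintype.card, ← Finset.prod_const, ← Finset.prod_mul_distrib]
  refine Finset.prod_congr rfl fun i _ => ?_
  simp [sg]; ring

theorem ker_lower {X I : Type} [Fintype I] [DecidableEq I] (b : I → X → ℝ) (κ : ℝ)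
    (h0 : 0 ≤ κ) (h1 : κ < 1) (h2 : κ * Fintype.card I ≤ 1/2)
    (hb : ∀ i σ, |b i σ| ≤ 1) (σ : X) (ξ : I → Bool) :
    (1/2) ^ Fintype.card I * (1/2) ≤ ker b κ σ ξ := by
  have a : ∏ i : I, ((1/2) * (1 - κ)) ≤ ker b κ σ ξ := by
    unfold ker
    refine Finset.prod_le_prod (fun i _ => by linarith) fun i _ => ?_
    have := ker_aux b κ h0 hb i σ (ξ i)
    linarith
  rw [Finset.prod_const, mul_pow] at a
  refine le_trans (mul_le_mul_of_nonneg_left ?_ (by positivity)) a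
  have := one_add_mul_le_pow (a := -κ) (by linarith) (Fintype.card I)
  have e : (1 + -κ) = 1 - κ := by ring
  rw [e] at this
  rw [Finset.card_univ]
  linarith

theorem info {X I : Type} [Fintype X] [Fintype I] [DecidableEq I] (b : I → X → ℝ) (κ : ℝ)
    (h0 : 0 ≤ κ) (h1 : κ < 1) (h2 : κ * Fintype.card I ≤ 1/2)
    (h3 : κ ^ 2 * (8 * 3 ^ Fintype.card I) ≤ 1)
    (hb : ∀ i σ, |b i σ| ≤ 1)
    (ν μ : X → ℝ) (hν : ∀ σ, 0 < ν σ) (hμ : ∀ σ, 0 < μ σ)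
    (hν1 : ∑ σ, ν σ = 1) (hμ1 : ∑ σ, μ σ = 1) (K : ℝ)
    (hES : ∑ i, (∑ σ, (ν σ - μ σ) * b i σ) ^ 2 ≤ K * Lf ν μ) :
    ∑ ξ, (∑ σ, ν σ * ker b κ σ ξ) * 
      Real.log ((∑ σ, ν σ * ker b κ σ ξ) / ∑ σ, μ σ * ker b κ σ ξ) ≤
      κ ^ 2 * (2 * K + 1) * Lf ν μ := by
  have hL := Lf_nonneg ν μ hν hμ
  set N := fun ξ => ∑ σ, ν σ * ker b κ σ ξ with hN
  set M := fun ξ => ∑ σ, μ σ * ker b κ σ ξ with hM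
  have hX : Nonempty X := by
    by_contra h
    rw [not_nonempty_iff] at h
    simp at hν1
  have hNpos : ∀ ξ, 0 < N ξ := fun ξ =>
    Finset.sum_pos (fun σ _ => mul_pos (hν σ) (ker_pos b κ h0 h1 hb σ ξ)) Finset.univ_nonempty
  set c : ℝ := (1/2) ^ Fintype.card I with hc
  have hcpos : 0 < c := by positivity
  have hMl : ∀ ξ, c * (1/2) ≤ M ξ := by
    intro ξ
    calc c * (1/2) = ∑ σ, μ σ * (c * (1/2)) := by rw [← Finset.sum_mul, hμ1, one_mul]
      _ ≤ _ := Finset.sum_le_sum fun σ _ => 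
        mul_le_mul_of_nonneg_left (ker_lower b κ h0 h1 h2 hb σ ξ) (hμ σ).le
  have hMpos : ∀ ξ, 0 < M ξ := fun ξ => lt_of_lt_of_le (by positivity) (hMl ξ)
  have hsum : ∀ ρ : X → ℝ, ∑ ξ, ∑ σ, ρ σ * ker b κ σ ξ = ∑ σ, ρ σ := by
    intro ρ
    rw [Finset.sum_comm]
    simp only [← Finset.mul_sum, ker_sum, mul_one]
  have hN1 : ∑ ξ, N ξ = 1 := by rw [hN, hsum, hν1]
  have hM1 : ∑ ξ, M ξ = 1 := by rw [hM, hsum, hμ1]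
  have s1 : ∀ ξ, N ξ * Real.log (N ξ / M ξ) ≤ (N ξ - M ξ) ^ 2 * (2 / c) + (N ξ - M ξ) := by
    intro ξ
    have a := Real.log_le_sub_one_of_pos (div_pos (hNpos ξ) (hMpos ξ))
    have a2 := mul_le_mul_of_nonneg_left a (hNpos ξ).le
    have a3 : N ξ * (N ξ / M ξ - 1) = (N ξ - M ξ) ^ 2 / M ξ + (N ξ - M ξ) := by
      have := (hMpos ξ).ne'
      field_simp; ring
    rw [a3] at a2
    have a4 : (N ξ - M ξ) ^ 2 / M ξ ≤ (N ξ - M ξ) ^ 2 * (2 / c) := by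
      rw [div_eq_mul_inv]
      refine mul_le_mul_of_nonneg_left ?_ (sq_nonneg _)
      rw [inv_le_comm₀ (hMpos ξ) (by positivity)]
      refine le_trans (le_of_eq ?_) (hMl ξ)
      field_simp
    linarith
  have s2 : ∑ ξ, N ξ * Real.log (N ξ / M ξ) ≤ (∑ ξ, (N ξ - M ξ) ^ 2) * (2 / c) := by
    have := Finset.sum_le_sum fun ξ (_ : ξ ∈ Finset.univ) => s1 ξ
    rw [Finset.sum_add_distrib, Finset.sum_sub_distrib, hN1, hM1, ← Finset.sum_mul] at this
    linarith
  set d := fun σ => ν σ - μ σ with hd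
  have s3 : ∀ ξ, N ξ - M ξ = ∑ σ, d σ * ker b κ σ ξ := by
    intro ξ
    simp only [hN, hM, hd, ← Finset.sum_sub_distrib, sub_mul]
  have s4 : ∑ ξ, (N ξ - M ξ) ^ 2 = c * ∑ σ, ∑ τ, d σ * d τ * ∏ i, (1 + κ ^ 2 * b i σ * b i τ) := by
    simp only [s3, sq (∑ σ, d σ * ker b κ σ _), Finset.sum_mul_sum]
    rw [Finset.sum_comm, Finset.mul_sum]
    refine Finset.sum_congr rfl fun σ _ => ?_
    rw [Finset.sum_comm, Finset.mul_sum]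
    refine Finset.sum_congr rfl fun τ _ => ?_
    have : ∀ ξ, d σ * ker b κ σ ξ * (d τ * ker b κ τ ξ) = d σ * d τ * (ker b κ σ ξ * ker b κ τ ξ) :=
      fun ξ => by ring
    simp only [this]
    rw [← Finset.mul_sum, ker_sum2]
    ring
  have hd0 : ∑ σ, d σ = 0 := by simp [hd, hν1, hμ1]
  set E := κ ^ 4 * 3 ^ Fintype.card I with hE
  have s5 : ∑ σ, ∑ τ, d σ * d τ * ∏ i, (1 + κ ^ 2 * b i σ * b i τ) ≤
      κ ^ 2 * ∑ i, (∑ σ, d σ * b i σ) ^ 2 + E * (∑ σ, |d σ|) ^ 2 := by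
    have a1 : ∀ σ τ, d σ * d τ * ∏ i, (1 + κ ^ 2 * b i σ * b i τ) ≤
        d σ * d τ + d σ * d τ * (∑ i, κ ^ 2 * b i σ * b i τ) + E * (|d σ| * |d τ|) := by
      intro σ τ
      have := (prod_err Finset.univ (fun i => κ ^ 2 * b i σ * b i τ) (κ ^ 2) (sq_nonneg _)
        (by nlinarith) (fun i => by
          rw [mul_assoc, abs_mul, abs_mul, abs_of_nonneg (sq_nonneg κ)]
          exact mul_le_of_le_one_right (sq_nonneg _) 
            (mul_le_one₀ (hb i σ) (abs_nonneg _) (hb i τ)))).1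
      set P := ∏ i, (1 + κ ^ 2 * b i σ * b i τ)
      set S := ∑ i, κ ^ 2 * b i σ * b i τ
      have h5 : d σ * d τ * (P - 1 - S) ≤ |d σ| * |d τ| * E := by
        refine (le_abs_self _).trans ?_
        rw [abs_mul, abs_mul]
        refine mul_le_mul_of_nonneg_left ?_ (by positivity)
        refine this.trans (le_of_eq ?_)
        rw [hE, Finset.card_univ]; ring
      nlinarith
    refine (Finset.sum_le_sum fun σ _ => Finset.sum_le_sum fun τ _ => a1 σ τ).trans (le_of_eq ?_)
    simp only [Finset.sum_add_distrib]
    have b1 : ∑ σ, ∑ τ, d σ * d τ = 0 := by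
      rw [← Finset.sum_mul_sum, hd0, zero_mul]
    have b2 : ∑ σ, ∑ τ, E * (|d σ| * |d τ|) = E * (∑ σ, |d σ|) ^ 2 := by
      rw [sq, Finset.sum_mul_sum, Finset.mul_sum]
      exact Finset.sum_congr rfl fun σ _ => (Finset.mul_sum _ _ _).symm
    have b3 : ∑ σ, ∑ τ, d σ * d τ * (∑ i, κ ^ 2 * b i σ * b i τ) = 
        κ ^ 2 * ∑ i, (∑ σ, d σ * b i σ) ^ 2 := by
      rw [Finset.mul_sum]
      have e : ∀ i, κ ^ 2 * (∑ σ, d σ * b i σ) ^ 2 = ∑ σ, ∑ τ, κ ^ 2 * (d σ * b i σ * (d τ * b i τ)) := by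
        intro i
        rw [sq (∑ σ, d σ * b i σ), Finset.sum_mul_sum, Finset.mul_sum]
        exact Finset.sum_congr rfl fun σ _ => Finset.mul_sum _ _ _
      simp only [e]
      conv_rhs => rw [Finset.sum_comm]
      refine Finset.sum_congr rfl fun σ _ => ?_
      conv_rhs => rw [Finset.sum_comm]
      refine Finset.sum_congr rfl fun τ _ => ?_
      rw [Finset.mul_sum]
      exact Finset.sum_congr rfl fun i _ => by ring
    rw [b1, b2, b3]; ring
  have hp := pinsker ν μ hν hμ hν1 hμ1
  have hEb : E * (∑ σ, |d σ|) ^ 2 ≤ κ ^ 2 * (1/2) * Lf ν μ := by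
    have e1 : E * (∑ σ, |d σ|) ^ 2 ≤ E * (4 * Lf ν μ) :=
      mul_le_mul_of_nonneg_left hp (by positivity)
    have e2 : E * 8 ≤ κ ^ 2 := by
      have := mul_le_mul_of_nonneg_left h3 (sq_nonneg κ)
      rw [hE]; nlinarith
    nlinarith
  have hES' := mul_le_mul_of_nonneg_left hES (sq_nonneg κ)
  calc _ ≤ _ := s2
    _ = 2 * ∑ σ, ∑ τ, d σ * d τ * ∏ i, (1 + κ ^ 2 * b i σ * b i τ) := by
      rw [s4]; field_simp
    _ ≤ 2 * (κ ^ 2 * (K * Lf ν μ) + κ ^ 2 * (1/2) * Lf ν μ) := by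
      linarith
    _ = _ := by ring

end IsingAux

namespace IsingAux
variable {V : Type} [Fintype V] [DecidableEq V]

def wt (M : V → V → ℝ) (h : V → ℝ) (σ : Conf V) : ℝ :=
  Real.exp ((1/2) * (∑ u, ∑ v, M u v * sg (σ u) * sg (σ v)) + ∑ u, h u * sg (σ u))

theorem wt_pos (M : V → V → ℝ) (h : V → ℝ) (σ : Conf V) : 0 < wt M h σ := Real.exp_pos _

def Ex (w g : Conf V → ℝ) : ℝ := (∑ σ, w σ * g σ) / ∑ σ, w σ

def aS (w : Conf V → ℝ) (u : V) (s : Bool) : ℝ := ∑ σ, w (Function.update σ u s)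

def condE (w : Conf V → ℝ) (u : V) (s : Bool) (g : Conf V → ℝ) : ℝ :=
  aS (fun σ => w σ * g σ) u s / aS w u s

def Dinf (w : Conf V → ℝ) (u : V) (g : Conf V → ℝ) : ℝ := condE w u true g - condE w u false g

theorem aS_pos (w : Conf V → ℝ) (hw : ∀ σ, 0 < w σ) (u : V) (s : Bool) : 0 < aS w u s :=
  Finset.sum_pos (fun _ _ => hw _) Finset.univ_nonempty

theorem aS_add (w : Conf V → ℝ) (u : V) : aS w u true + aS w u false = 2 * ∑ σ, w σ := by
  rw [← sum_Sv u w]; unfold aS Sv; rw [Finset.sum_add_distrib]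

theorem aS_exp (w : Conf V → ℝ) (u : V) (s : Bool) (c : ℝ) :
    aS (fun σ => w σ * Real.exp (c * sg (σ u))) u s = Real.exp (c * sg s) * aS w u s := by
  unfold aS; simp only [Function.update_self]; rw [Finset.mul_sum]
  exact Finset.sum_congr rfl fun _ _ => mul_comm _ _

theorem aS_exp' (w g : Conf V → ℝ) (u : V) (s : Bool) (c : ℝ) :
    aS (fun σ => w σ * Real.exp (c * sg (σ u)) * g σ) u s =
      Real.exp (c * sg s) * aS (fun σ => w σ * g σ) u s := by
  unfold aS; simp only [Function.update_self]; rw [Finset.mul_sum]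
  exact Finset.sum_congr rfl fun _ _ => by ring

theorem Ex_exp (w g : Conf V → ℝ) (u : V) (c : ℝ) :
    Ex (fun σ => w σ * Real.exp (c * sg (σ u))) g =
    (Real.exp c * aS (fun σ => w σ * g σ) u true + Real.exp (-c) * aS (fun σ => w σ * g σ) u false) /
    (Real.exp c * aS w u true + Real.exp (-c) * aS w u false) := by
  have h1 := aS_add (fun σ => w σ * Real.exp (c * sg (σ u))) u
  have h2 := aS_add (fun σ => w σ * Real.exp (c * sg (σ u)) * g σ) u
  rw [aS_exp, aS_exp] at h1
  rw [aS_exp', aS_exp'] at h2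
  have st : sg true = 1 := rfl
  have sf : sg false = -1 := rfl
  simp only [st, sf, mul_one, mul_neg] at h1 h2
  unfold Ex
  rw [h1, h2, mul_div_mul_left _ _ two_ne_zero]

theorem alg1 (e f p m P Q t : ℝ) (he : 0 < e) (hf : 0 < f) (hp : 0 < p) (hm : 0 < m)
    (ht : |e - f| ≤ t * (e + f)) :
    |(e * P + f * Q) / (e * p + f * m) - (f * P + e * Q) / (f * p + e * m)| ≤ t * |P / p - Q / m| := by
  have h1 : (e * P + f * Q) / (e * p + f * m) - (f * P + e * Q) / (f * p + e * m)
      = ((e - f) * (e + f) * (p * m)) / ((e * p + f * m) * (f * p + e * m)) * (P / p - Q / m) := by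
    field_simp
    ring
  rw [h1, abs_mul]
  refine mul_le_mul_of_nonneg_right ?_ (abs_nonneg _)
  rw [abs_div, abs_mul, abs_mul, abs_of_pos (show 0 < e + f by positivity),
    abs_of_pos (show 0 < p * m by positivity),
    abs_of_pos (show 0 < (e * p + f * m) * (f * p + e * m) by positivity), div_le_iff₀ (by positivity)]
  have h2 : (e + f) * (e + f) * (p * m) ≤ (e * p + f * m) * (f * p + e * m) := by
    nlinarith [mul_nonneg (mul_pos he hf).le (sq_nonneg (p - m))]
  have ht0 : 0 ≤ t := by
    by_contra hc
    have := abs_nonneg (e - f)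
    nlinarith
  calc _ ≤ t * (e + f) * (e + f) * (p * m) := by gcongr
    _ = t * ((e + f) * (e + f) * (p * m)) := by ring
    _ ≤ _ := mul_le_mul_of_nonneg_left h2 ht0

theorem field_change (w g : Conf V → ℝ) (hw : ∀ σ, 0 < w σ) (u : V) (c t : ℝ)
    (ht : |Real.exp c - Real.exp (-c)| ≤ t * (Real.exp c + Real.exp (-c))) :
    |Ex (fun σ => w σ * Real.exp (c * sg (σ u))) g - Ex (fun σ => w σ * Real.exp (-c * sg (σ u))) g|
      ≤ t * |Dinf w u g| := by
  rw [Ex_exp, Ex_exp, neg_neg]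
  exact alg1 _ _ _ _ _ _ t (Real.exp_pos _) (Real.exp_pos _) (aS_pos w hw u true)
    (aS_pos w hw u false) ht

theorem wt_field (M : V → V → ℝ) (h : V → ℝ) (u : V) (c : ℝ) :
    wt M (h + Pi.single u c) = fun σ => wt M h σ * Real.exp (c * sg (σ u)) := by
  funext σ
  unfold wt
  rw [← Real.exp_add]
  congr 1
  simp only [Pi.add_apply, add_mul, Finset.sum_add_distrib, Pi.single_apply, ite_mul, zero_mul,
    Finset.sum_ite_eq', Finset.mem_univ, if_true]
  ring

def xs (v : V) (σ : Conf V) : ℝ := sg (σ v)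

theorem telescope (M : V → V → ℝ) (t R : ℝ) (ht0 : 0 ≤ t) (N : Finset V) :
    ∀ (k h : V → ℝ), (∀ u, u ∉ N → k u = 0) →
    (∀ u ∈ N, |Real.exp (k u) - Real.exp (-(k u))| ≤ t * (Real.exp (k u) + Real.exp (-(k u)))) →
    (∀ u ∈ N, ∀ h, ∑ v, |Dinf (wt M h) u (xs v)| ≤ R) →
    ∑ v, |Ex (wt M (h + k)) (xs v) - Ex (wt M (h - k)) (xs v)| ≤ N.card * (t * R) := by
  induction N using Finset.induction_on with
  | empty =>
    intro k h hk _ _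
    have : k = 0 := funext fun u => hk u (by simp)
    simp [this]
  | insert u N hu ih =>
    intro k h hk hkt hR
    set k' : V → ℝ := Function.update k u 0 with hk'
    have hkk : k = k' + Pi.single u (k u) := by
      funext v
      by_cases hv : v = u
      · subst hv; simp [hk']
      · simp [hk', hv]
    have hk0 : ∀ v, v ∉ N → k' v = 0 := by
      intro v hv
      by_cases hvu : v = u
      · subst hvu; simp [hk']
      · simp only [hk', Function.update_of_ne hvu]; exact hk v (by simp [hv, hvu])
    have hne : ∀ v ∈ N, v ≠ u := fun v hv h => hu (h ▸ hv)
    have h2 := ih k' (h + Pi.single u (-(k u))) hk0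
      (fun v hv => by
        simp only [hk', Function.update_of_ne (hne v hv)]
        exact hkt v (by simp [hv]))
      (fun v hv => hR v (by simp [hv]))
    have h1 : ∀ v, |Ex (wt M (h + k)) (xs v) - Ex (wt M (h + Pi.single u (-(k u)) + k')) (xs v)|
        ≤ t * |Dinf (wt M (h + k')) u (xs v)| := by
      intro v
      have e1 : h + k = (h + k') + Pi.single u (k u) := by
        rw [add_assoc, ← hkk]
      have e2 : h + Pi.single u (-(k u)) + k' = (h + k') + Pi.single u (-(k u)) := by abel
      rw [e1, e2, wt_field, wt_field]
      exact field_change _ _ (wt_pos _ _) u _ t (hkt u (by simp))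
    have e3 : h - k = h + Pi.single u (-(k u)) - k' := by
      conv_lhs => rw [hkk]
      have : (Pi.single u (-(k u)) : V → ℝ) = - Pi.single u (k u) := by rw [Pi.single_neg]
      rw [this]; abel
    rw [Finset.card_insert_of_notMem hu]
    calc _ ≤ ∑ v, (t * |Dinf (wt M (h + k')) u (xs v)| +
          |Ex (wt M (h + Pi.single u (-(k u)) + k')) (xs v) -
            Ex (wt M (h + Pi.single u (-(k u)) - k')) (xs v)|) := by
          refine Finset.sum_le_sum fun v _ => ?_
          rw [e3]
          exact (abs_sub_le _ _ _).trans (add_le_add (h1 v) le_rfl)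
      _ ≤ t * R + N.card * (t * R) := by
          rw [Finset.sum_add_distrib, ← Finset.mul_sum]
          exact add_le_add (mul_le_mul_of_nonneg_left (hR u (by simp) _) ht0) h2
      _ = _ := by push_cast; ring

/-- zero out row and column `u` -/
def Mz (M : V → V → ℝ) (u : V) (a b : V) : ℝ := if a = u ∨ b = u then 0 else M a b

theorem wt_update (M : V → V → ℝ) (hM : ∀ a b, M a b = M b a) (hd : ∀ a, M a a = 0)
    (h : V → ℝ) (u : V) (s : Bool) (σ : Conf V) :
    wt M h (Function.update σ u s) = Real.exp (h u * sg s) *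
      wt (Mz M u) (Function.update h u 0 + sg s • M u) σ := by
  unfold wt
  rw [← Real.exp_add]
  congr 1
  have e1 : ∀ a b, M a b * sg (Function.update σ u s a) * sg (Function.update σ u s b) =
      Mz M u a b * sg (σ a) * sg (σ b) + (if a = u then sg s * M u b * sg (σ b) else 0)
        + (if b = u then sg s * M u a * sg (σ a) else 0) := by
    intro a b
    by_cases ha : a = u
    · subst ha
      by_cases hb : b = a
      · subst hb; simp [hd, Mz]
      · simp only [Mz, Function.update_self, Function.update_of_ne hb, hb, if_true, if_false, true_or, zero_mul]; ring
    · by_cases hb : b = u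
      · subst hb; simp [Mz, ha, hM a b]; ring
      · simp [Mz, ha, hb]
  have e2 : ∀ a, h a * sg (Function.update σ u s a) = (if a = u then h u * sg s else 0) +
      Function.update h u 0 a * sg (σ a) := by
    intro a
    by_cases ha : a = u
    · subst ha; simp
    · simp [ha]
  simp only [e1, e2, Finset.sum_add_distrib, Pi.add_apply, Pi.smul_apply, smul_eq_mul, add_mul]
  have e3 : ∑ x : V, ∑ x_1 : V, (if x = u then sg s * M u x_1 * sg (σ x_1) else 0) =
      ∑ b, sg s * M u b * sg (σ b) := by
    rw [Finset.sum_comm]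
    exact Finset.sum_congr rfl fun b _ => by simp
  rw [e3]
  simp only [Finset.sum_ite_eq', Finset.mem_univ, if_true]
  ring

theorem condE_eq (M : V → V → ℝ) (hM : ∀ a b, M a b = M b a) (hd : ∀ a, M a a = 0)
    (h : V → ℝ) (u : V) (s : Bool) (v : V) (hv : v ≠ u) :
    condE (wt M h) u s (xs v) = Ex (wt (Mz M u) (Function.update h u 0 + sg s • M u)) (xs v) := by
  unfold condE aS Ex
  simp only [wt_update M hM hd, xs, Function.update_of_ne hv, mul_assoc]
  rw [← Finset.mul_sum, ← Finset.mul_sum, mul_div_mul_left _ _ (Real.exp_pos _).ne']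

theorem condE_self (w : Conf V → ℝ) (hw : ∀ σ, 0 < w σ) (u : V) (s : Bool) :
    condE w u s (xs u) = sg s := by
  have := aS_pos w hw u s
  unfold condE
  rw [div_eq_iff this.ne']
  unfold aS
  simp only [xs, Function.update_self]
  rw [Finset.mul_sum]
  exact Finset.sum_congr rfl fun _ _ => mul_comm _ _

def nb (M : V → V → ℝ) (u : V) : Finset V := Finset.univ.filter (fun v => M u v ≠ 0)

theorem dinf_step (M : V → V → ℝ) (hM : ∀ a b, M a b = M b a) (hd : ∀ a, M a a = 0)
    (t R : ℝ) (ht0 : 0 ≤ t)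
    (ht : ∀ a b, |Real.exp (M a b) - Real.exp (-(M a b))| ≤ t * (Real.exp (M a b) + Real.exp (-(M a b))))
    (u : V) (hR : ∀ w ∈ nb M u, ∀ h, ∑ v, |Dinf (wt (Mz M u) h) w (xs v)| ≤ R) (h : V → ℝ) :
    ∑ v, |Dinf (wt M h) u (xs v)| ≤ 2 + (nb M u).card * (t * R) := by
  have h1 := telescope (Mz M u) t R ht0 (nb M u) (M u) (Function.update h u 0)
    (fun v hv => by simpa [nb] using hv) (fun v _ => ht u v) hR
  have h2 : ∀ v, |Dinf (wt M h) u (xs v)| ≤ (if v = u then 2 else 0) +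
      |Ex (wt (Mz M u) (Function.update h u 0 + M u)) (xs v) -
        Ex (wt (Mz M u) (Function.update h u 0 - M u)) (xs v)| := by
    intro v
    by_cases hv : v = u
    · subst hv
      unfold Dinf
      rw [condE_self _ (wt_pos _ _), condE_self _ (wt_pos _ _)]
      simp only [sg, if_true]
      norm_num
    · unfold Dinf
      rw [condE_eq M hM hd h u _ v hv, condE_eq M hM hd h u _ v hv]
      simp only [sg, one_smul, neg_smul, hv, if_false, zero_add, ← sub_eq_add_neg]
      exact le_rfl
  calc _ ≤ _ := Finset.sum_le_sum fun v _ => h2 v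
    _ = 2 + ∑ v, |Ex (wt (Mz M u) (Function.update h u 0 + M u)) (xs v) -
        Ex (wt (Mz M u) (Function.update h u 0 - M u)) (xs v)| := by
        rw [Finset.sum_add_distrib]; simp
    _ ≤ _ := by linarith

theorem nb_Mz (M : V → V → ℝ) (hM : ∀ a b, M a b = M b a) (u w : V) :
    nb (Mz M u) w ⊆ (nb M w).erase u := by
  intro a ha
  simp only [nb, Finset.mem_filter, Finset.mem_univ, true_and, Finset.mem_erase] at ha ⊢
  unfold Mz at ha
  by_cases h1 : w = u ∨ a = u
  · rw [if_pos h1] at ha; exact absurd rfl ha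
  · rw [if_neg h1] at ha
    push Not at h1
    exact ⟨h1.2, ha⟩

theorem dinf_ind (D : ℕ) (t δ : ℝ) (ht0 : 0 ≤ t) (hδ : 0 < δ) (hDt : D * t ≤ 1 - δ) (m : ℕ) :
    ∀ (M : V → V → ℝ) (S : Finset V), (∀ a b, M a b = M b a) → (∀ a, M a a = 0) →
    (∀ a b, |Real.exp (M a b) - Real.exp (-(M a b))| ≤ t * (Real.exp (M a b) + Real.exp (-(M a b)))) →
    (∀ u, (nb M u).card ≤ D + 1) → (∀ a b, M a b ≠ 0 → a ∈ S) → S.card ≤ m →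
    ∀ u, (nb M u).card ≤ D → ∀ h, ∑ v, |Dinf (wt M h) u (xs v)| ≤ 2 / δ := by
  have key : ∀ n : ℕ, n ≤ D → (2:ℝ) + n * (t * (2 / δ)) ≤ 2 / δ := by
    intro n hn
    have : (n:ℝ) * t ≤ 1 - δ := (mul_le_mul_of_nonneg_right (Nat.cast_le.mpr hn) ht0).trans hDt
    calc (2:ℝ) + n * (t * (2 / δ)) = 2 + (n * t) * (2 / δ) := by ring
      _ ≤ 2 + (1 - δ) * (2 / δ) := by
        have h0 : 0 ≤ 2 / δ := by positivity
        linarith [mul_le_mul_of_nonneg_right this h0]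
      _ = 2 / δ := by field_simp; ring
  induction m with
  | zero =>
    intro M S hM hd ht hdeg hS hc u hu h
    refine (dinf_step M hM hd t (2/δ) ht0 ht u ?_ h).trans (key _ hu)
    intro w hw
    have := hS u w (by simpa [nb] using hw)
    rw [Finset.card_eq_zero.mp (by omega : S.card = 0)] at this
    simp at this
  | succ m ih =>
    intro M S hM hd ht hdeg hS hc u hu h
    refine (dinf_step M hM hd t (2/δ) ht0 ht u ?_ h).trans (key _ hu)
    intro w hw
    have hw' : M u w ≠ 0 := by simpa [nb] using hw
    have huS := hS u w hw'
    refine ih (Mz M u) (S.erase u) ?_ ?_ ?_ ?_ ?_ ?_ w ?_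
    · intro a b; unfold Mz; rw [hM a b]; congr 1; rw [or_comm]
    · intro a; simp [Mz, hd]
    · intro a b; unfold Mz; split_ifs
      · simp; exact ht0
      · exact ht a b
    · intro a
      exact (Finset.card_le_card ((nb_Mz M hM u a).trans (Finset.erase_subset _ _))).trans (hdeg a)
    · intro a b hab
      unfold Mz at hab
      by_cases h1 : a = u ∨ b = u
      · simp [h1] at hab
      · push Not at h1
        simp [h1] at hab
        exact Finset.mem_erase.mpr ⟨h1.1, hS a b hab⟩
    · rw [Finset.card_erase_of_mem huS]; omega
    · have h3 := Finset.card_le_card (nb_Mz M hM u w)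
      rw [Finset.card_erase_of_mem (by simp [nb, hM w u, hw'])] at h3
      have := hdeg w
      omega

theorem dinf_all (D : ℕ) (t δ : ℝ) (ht0 : 0 ≤ t) (hδ : 0 < δ) (hDt : D * t ≤ 1 - δ)
    (M : V → V → ℝ) (hM : ∀ a b, M a b = M b a) (hd : ∀ a, M a a = 0)
    (ht : ∀ a b, |Real.exp (M a b) - Real.exp (-(M a b))| ≤ t * (Real.exp (M a b) + Real.exp (-(M a b))))
    (hdeg : ∀ u, (nb M u).card ≤ D + 1) (u : V) (h : V → ℝ) :
    ∑ v, |Dinf (wt M h) u (xs v)| ≤ 2 * (1 + (D + 1) * t / δ) := by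
  have h1 := dinf_step M hM hd t (2/δ) ht0 ht u ?_ h
  · refine h1.trans ?_
    have : ((nb M u).card : ℝ) ≤ D + 1 := by exact_mod_cast hdeg u
    calc (2:ℝ) + (nb M u).card * (t * (2 / δ)) ≤ 2 + (D + 1) * (t * (2 / δ)) := by gcongr
      _ = _ := by ring
  · intro w hw
    have hw' : M u w ≠ 0 := by simpa [nb] using hw
    refine dinf_ind D t δ ht0 hδ hDt (Finset.univ : Finset V).card (Mz M u) Finset.univ ?_ ?_ ?_ ?_ ?_ le_rfl w ?_
    · intro a b; unfold Mz; rw [hM a b]; congr 1; rw [or_comm]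
    · intro a; simp [Mz, hd]
    · intro a b; unfold Mz; split_ifs
      · simp; exact ht0
      · exact ht a b
    · intro a
      exact (Finset.card_le_card ((nb_Mz M hM u a).trans (Finset.erase_subset _ _))).trans (hdeg a)
    · intro a b _; simp
    · have h3 := Finset.card_le_card (nb_Mz M hM u w)
      rw [Finset.card_erase_of_mem (by simp [nb, hM w u, hw'])] at h3
      have := hdeg w
      omega

end IsingAux

namespace IsingAux
variable {V : Type} [Fintype V] [DecidableEq V]

theorem cov_dinf (w g : Conf V → ℝ) (hw : ∀ σ, 0 < w σ) (u : V) :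
    |Ex w (fun σ => xs u σ * g σ) - Ex w (xs u) * Ex w g| ≤ (1/2) * |Dinf w u g| := by
  have h1 := aS_add w u
  have h2 := aS_add (fun σ => w σ * g σ) u
  have h3 := aS_add (fun σ => w σ * (xs u σ * g σ)) u
  have h4 := aS_add (fun σ => w σ * xs u σ) u
  have e3 : ∀ s, aS (fun σ => w σ * (xs u σ * g σ)) u s = sg s * aS (fun σ => w σ * g σ) u s := by
    intro s; unfold aS; rw [Finset.mul_sum]
    refine Finset.sum_congr rfl fun σ _ => ?_
    simp only [xs, Function.update_self]; ring
  have e4 : ∀ s, aS (fun σ => w σ * xs u σ) u s = sg s * aS w u s := by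
    intro s; unfold aS; rw [Finset.mul_sum]
    refine Finset.sum_congr rfl fun σ _ => ?_
    simp only [xs, Function.update_self]; ring
  rw [e3, e3] at h3
  rw [e4, e4] at h4
  have st : sg true = 1 := rfl
  have sf : sg false = -1 := rfl
  rw [st, sf] at h3 h4
  have hp := aS_pos w hw u true
  have hm := aS_pos w hw u false
  unfold Ex Dinf condE
  generalize aS w u true = p at *
  generalize aS w u false = m at *
  generalize aS (fun σ => w σ * g σ) u true = P at *
  generalize aS (fun σ => w σ * g σ) u false = Q at *
  have i1 : ∑ σ, w σ = (p + m) / 2 := by linarith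
  have i2 : ∑ σ, w σ * g σ = (P + Q) / 2 := by linarith
  have i3 : ∑ σ, w σ * (xs u σ * g σ) = (P - Q) / 2 := by linarith
  have i4 : ∑ σ, w σ * xs u σ = (p - m) / 2 := by linarith
  rw [i1, i2, i3, i4]
  have e : (P - Q) / 2 / ((p + m) / 2) - (p - m) / 2 / ((p + m) / 2) * ((P + Q) / 2 / ((p + m) / 2))
      = (2 * p * m / (p + m) ^ 2) * (P / p - Q / m) := by
    field_simp; ring
  rw [e, abs_mul]
  refine mul_le_mul_of_nonneg_right ?_ (abs_nonneg _)
  rw [abs_of_pos (by positivity), div_le_iff₀ (by positivity)]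
  nlinarith [sq_nonneg (p - m)]

theorem Ex_sum {ι : Type*} (s : Finset ι) (w : Conf V → ℝ) (c : ι → ℝ) (f : ι → Conf V → ℝ) :
    Ex w (fun σ => ∑ i ∈ s, c i * f i σ) = ∑ i ∈ s, c i * Ex w (f i) := by
  unfold Ex
  simp only [Finset.mul_sum]
  rw [Finset.sum_comm, Finset.sum_div]
  refine Finset.sum_congr rfl fun i _ => ?_
  rw [mul_div_assoc', Finset.mul_sum]
  congr 1
  exact Finset.sum_congr rfl fun σ _ => by ring

def ly (c : V → ℝ) (σ : Conf V) : ℝ := ∑ u, c u * xs u σ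

theorem var_bound (w : Conf V → ℝ) (hw : ∀ σ, 0 < w σ) (K : ℝ)
    (hK : ∀ u, ∑ v, |Dinf w u (xs v)| ≤ 2 * K) (c : V → ℝ) :
    Ex w (fun σ => ly c σ * ly c σ) - Ex w (ly c) * Ex w (ly c) ≤ K * ∑ u, c u ^ 2 := by
  set cov : V → V → ℝ := fun u v => Ex w (fun σ => xs u σ * xs v σ) - Ex w (xs u) * Ex w (xs v) with hcov
  have hs : ∀ u v, cov u v = cov v u := by
    intro u v; simp only [hcov, mul_comm]
  have hr : ∀ u, ∑ v, |cov u v| ≤ K := by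
    intro u
    calc _ ≤ ∑ v, (1/2) * |Dinf w u (xs v)| := Finset.sum_le_sum fun v _ => cov_dinf w (xs v) hw u
      _ ≤ K := by rw [← Finset.mul_sum]; linarith [hK u]
  have e1 : Ex w (ly c) = ∑ u, c u * Ex w (xs u) := Ex_sum _ w c xs
  have e2 : Ex w (fun σ => ly c σ * ly c σ) = ∑ u, ∑ v, c u * c v * Ex w (fun σ => xs u σ * xs v σ) := by
    have : (fun σ => ly c σ * ly c σ) = fun σ => ∑ p ∈ (Finset.univ ×ˢ Finset.univ : Finset (V × V)),
        (c p.1 * c p.2) * (xs p.1 σ * xs p.2 σ) := by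
      funext σ
      unfold ly
      rw [Finset.sum_mul_sum, ← Finset.sum_product']
      exact Finset.sum_congr rfl fun p _ => by ring
    rw [this, Ex_sum _ w (fun p : V × V => c p.1 * c p.2) (fun p σ => xs p.1 σ * xs p.2 σ), Finset.sum_product]
  have e3 : Ex w (fun σ => ly c σ * ly c σ) - Ex w (ly c) * Ex w (ly c) = ∑ u, ∑ v, c u * c v * cov u v := by
    rw [e2, e1, Finset.sum_mul_sum, ← Finset.sum_sub_distrib]
    refine Finset.sum_congr rfl fun u _ => ?_
    rw [← Finset.sum_sub_distrib]
    exact Finset.sum_congr rfl fun v _ => by simp only [hcov]; ring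
  rw [e3]
  have e4 : ∀ u v, c u * c v * cov u v ≤ (1/2) * (c u ^ 2 * |cov u v|) + (1/2) * (c v ^ 2 * |cov v u|) := by
    intro u v
    rw [hs v u]
    have a1 : c u * c v * cov u v ≤ |c u * c v| * |cov u v| := by
      rw [← abs_mul]; exact le_abs_self _
    have a2 : |c u * c v| ≤ (c u ^ 2 + c v ^ 2) / 2 := by
      rw [abs_le]; constructor <;> nlinarith [sq_nonneg (c u - c v), sq_nonneg (c u + c v)]
    nlinarith [mul_le_mul_of_nonneg_right a2 (abs_nonneg (cov u v))]
  have e5 : ∑ u, ∑ v, (1/2) * (c u ^ 2 * |cov u v|) ≤ (1/2) * (K * ∑ u, c u ^ 2) := by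
    rw [Finset.mul_sum, Finset.mul_sum]
    refine Finset.sum_le_sum fun u _ => ?_
    rw [← Finset.mul_sum, ← Finset.mul_sum]
    nlinarith [mul_le_mul_of_nonneg_left (hr u) (sq_nonneg (c u))]
  calc _ ≤ _ := Finset.sum_le_sum fun u _ => Finset.sum_le_sum fun v _ => e4 u v
    _ = ∑ u, ∑ v, (1/2) * (c u ^ 2 * |cov u v|) + ∑ u, ∑ v, (1/2) * (c u ^ 2 * |cov u v|) := by
      simp only [Finset.sum_add_distrib]
      congr 1
      rw [Finset.sum_comm]
    _ ≤ _ := by linarith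

theorem logZ {X : Type*} [Fintype X] [Nonempty X] (w y : X → ℝ) (hw : ∀ σ, 0 < w σ) (B : ℝ)
    (hB : ∀ s : ℝ, (∑ σ, w σ * Real.exp (s * y σ) * (y σ * y σ)) / (∑ σ, w σ * Real.exp (s * y σ))
      - (∑ σ, w σ * Real.exp (s * y σ) * y σ) / (∑ σ, w σ * Real.exp (s * y σ)) *
        ((∑ σ, w σ * Real.exp (s * y σ) * y σ) / (∑ σ, w σ * Real.exp (s * y σ))) ≤ B) :
    Real.log (∑ σ, w σ * Real.exp (y σ)) ≤ Real.log (∑ σ, w σ) + (∑ σ, w σ * y σ) / (∑ σ, w σ) + B / 2 := by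
  set Z : ℝ → ℝ := fun s => ∑ σ, w σ * Real.exp (s * y σ) with hZ
  set Z1 : ℝ → ℝ := fun s => ∑ σ, w σ * Real.exp (s * y σ) * y σ with hZ1
  set Z2 : ℝ → ℝ := fun s => ∑ σ, w σ * Real.exp (s * y σ) * (y σ * y σ) with hZ2
  have he : ∀ σ s, HasDerivAt (fun s => Real.exp (s * y σ)) (Real.exp (s * y σ) * y σ) s := by
    intro σ s
    have := ((hasDerivAt_id s).mul_const (y σ)).exp
    simpa using this
  have hZp : ∀ s, 0 < Z s := fun s => Finset.sum_pos (fun σ _ => mul_pos (hw σ) (Real.exp_pos _)) Finset.univ_nonempty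
  have d1 : ∀ s, HasDerivAt Z (Z1 s) s := by
    intro s
    have := HasDerivAt.fun_sum (u := (Finset.univ : Finset X)) fun σ _ => (he σ s).const_mul (w σ)
    refine this.congr_deriv ?_
    exact Finset.sum_congr rfl fun σ _ => by ring
  have d2 : ∀ s, HasDerivAt Z1 (Z2 s) s := by
    intro s
    have := HasDerivAt.fun_sum (u := (Finset.univ : Finset X)) fun σ _ => ((he σ s).const_mul (w σ)).mul_const (y σ)
    refine this.congr_deriv ?_
    exact Finset.sum_congr rfl fun σ _ => by ring
  have d3 : ∀ s, HasDerivAt (fun s => Z1 s / Z s - B * s) ((Z2 s * Z s - Z1 s * Z1 s) / (Z s)^2 - B) s := by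
    intro s
    have := ((d2 s).div (d1 s) (hZp s).ne').sub ((hasDerivAt_id s).const_mul B)
    exact this.congr_deriv (by rw [mul_one])
  have a1 : Antitone (fun s => Z1 s / Z s - B * s) := by
    refine antitone_of_hasDerivAt_nonpos d3 ?_
    intro s
    have h1 := hB s
    have h2 := (hZp s).ne'
    have : (Z2 s * Z s - Z1 s * Z1 s) / (Z s)^2 = Z2 s / Z s - Z1 s / Z s * (Z1 s / Z s) := by
      field_simp
    simp only [Pi.zero_apply]
    rw [this]
    simp only [hZ, hZ1, hZ2] at h1 ⊢
    linarith
  have d4 : ∀ s, HasDerivAt (fun s => Real.log (Z s) - (Z1 0 / Z 0) * s - B / 2 * s ^ 2)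
      (Z1 s / Z s - Z1 0 / Z 0 - B * s) s := by
    intro s
    have := (((d1 s).log (hZp s).ne').sub ((hasDerivAt_id s).const_mul (Z1 0 / Z 0))).sub
      (((hasDerivAt_id s).pow 2).const_mul (B/2))
    refine this.congr_deriv ?_
    simp only [id]; push_cast; ring
  have a2 : AntitoneOn (fun s => Real.log (Z s) - (Z1 0 / Z 0) * s - B / 2 * s ^ 2) (Set.Icc 0 1) := by
    refine antitoneOn_of_deriv_nonpos (convex_Icc 0 1) ?_ ?_ ?_
    · exact fun s _ => (d4 s).continuousAt.continuousWithinAt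
    · exact fun s _ => (d4 s).differentiableAt.differentiableWithinAt
    · intro s hs
      rw [interior_Icc] at hs
      rw [(d4 s).deriv]
      have := a1 hs.1.le
      simp only at this
      linarith
  have h := a2 (Set.left_mem_Icc.mpr zero_le_one) (Set.right_mem_Icc.mpr zero_le_one) zero_le_one
  simp only [hZ, hZ1, zero_mul, Real.exp_zero, mul_one, one_mul] at h
  linarith

theorem ent_stab (M : V → V → ℝ) (K : ℝ) (hK0 : 0 < K)
    (hK : ∀ h u, ∑ v, |Dinf (wt M h) u (xs v)| ≤ 2 * K) (h : V → ℝ) (ν : Conf V → ℝ)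
    (hν : ∀ σ, 0 < ν σ) (hν1 : ∑ σ, ν σ = 1) :
    ∑ u, (∑ σ, ν σ * xs u σ - Ex (wt M h) (xs u)) ^ 2 ≤ 2 * K * Lf ν (wt M h) := by
  set w := wt M h with hw
  have hwp : ∀ σ, 0 < w σ := wt_pos M h
  set d : V → ℝ := fun u => ∑ σ, ν σ * xs u σ - Ex w (xs u) with hd
  set c : V → ℝ := fun u => d u / K with hc
  have ht : ∀ s : ℝ, ∀ σ, w σ * Real.exp (s * ly c σ) = wt M (h + s • c) σ := by
    intro s σ
    rw [hw]; unfold wt; rw [← Real.exp_add]; congr 1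
    unfold ly xs
    simp only [Pi.add_apply, Pi.smul_apply, smul_eq_mul, add_mul, Finset.sum_add_distrib, Finset.mul_sum]
    rw [add_assoc]; congr 2
    exact Finset.sum_congr rfl fun u _ => by ring
  have hL := logZ w (ly c) hwp (K * ∑ u, c u ^ 2) (by
    intro s
    have := var_bound (wt M (h + s • c)) (wt_pos _ _) K (hK _) c
    simp only [ht]
    exact this)
  have hy : (∑ σ, w σ * ly c σ) / (∑ σ, w σ) = ∑ u, c u * Ex w (xs u) := Ex_sum _ w c xs
  rw [hy] at hL
  have hD := log_sum Finset.univ ν (fun σ => w σ * Real.exp (ly c σ)) (fun σ _ => hν σ)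
    (fun σ _ => mul_pos (hwp σ) (Real.exp_pos _))
  have e1 : ∀ σ, ν σ * Real.log (ν σ / (w σ * Real.exp (ly c σ))) = ν σ * Real.log (ν σ / w σ) - ν σ * ly c σ := by
    intro σ
    rw [← div_div, Real.log_div (div_pos (hν σ) (hwp σ)).ne' (Real.exp_pos _).ne', Real.log_exp]; ring
  have e2 : ∑ σ, ν σ * ly c σ = ∑ u, c u * ∑ σ, ν σ * xs u σ := by
    unfold ly
    simp only [Finset.mul_sum]
    rw [Finset.sum_comm]
    exact Finset.sum_congr rfl fun u _ => Finset.sum_congr rfl fun σ _ => by ring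
  simp only [e1, Finset.sum_sub_distrib] at hD
  rw [hν1, one_mul, one_div, Real.log_inv, e2] at hD
  have e3 : Lf ν w = ∑ σ, ν σ * Real.log (ν σ / w σ) + Real.log (∑ σ, w σ) := by
    unfold Lf; rw [hν1, one_mul, one_div, Real.log_inv]; ring
  have e4 : ∑ u, c u * ∑ σ, ν σ * xs u σ - ∑ u, c u * Ex w (xs u) = (∑ u, d u ^ 2) / K := by
    rw [← Finset.sum_sub_distrib, Finset.sum_div]
    exact Finset.sum_congr rfl fun u _ => by simp only [hc, hd]; ring
  have e5 : K * ∑ u, c u ^ 2 = (∑ u, d u ^ 2) / K := by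
    simp only [hc, div_pow]
    rw [← Finset.sum_div]; field_simp
  rw [e5] at hL
  have : (∑ u, d u ^ 2) / K ≤ 2 * Lf ν w := by rw [e3]; linarith
  rw [div_le_iff₀ hK0] at this
  linarith

end IsingAux

namespace IsingAux
variable {V : Type} [Fintype V] [DecidableEq V]

def bE (A : V → V → ℝ) (s : ℝ) (p : V × V) (σ : Conf V) : ℝ :=
  A p.1 p.2 * ((xs p.1 σ + s * xs p.2 σ) / 2)

theorem xs_cases (v : V) (σ : Conf V) : xs v σ = 1 ∨ xs v σ = -1 := by
  unfold xs; cases σ v <;> simp [sg]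

theorem bE_abs (A : V → V → ℝ) (hA : ∀ u v, A u v = 0 ∨ A u v = 1) (s : ℝ) (hs : s = 1 ∨ s = -1)
    (p : V × V) (σ : Conf V) : |bE A s p σ| ≤ 1 := by
  unfold bE
  rcases hA p.1 p.2 with h | h <;> rcases xs_cases p.1 σ with h1 | h1 <;>
    rcases xs_cases p.2 σ with h2 | h2 <;> rcases hs with h3 | h3 <;> rw [h, h1, h2, h3] <;> norm_num

theorem es_pairs (A : V → V → ℝ) (hA : ∀ u v, A u v = 0 ∨ A u v = 1) (hAs : ∀ u v, A u v = A v u)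
    (D : ℝ) (hdeg : ∀ u, ∑ v, A u v ≤ D) (s : ℝ) (hs : s = 1 ∨ s = -1) (d : V → ℝ) :
    ∑ p : V × V, (A p.1 p.2 * ((d p.1 + s * d p.2) / 2)) ^ 2 ≤ D * ∑ u, d u ^ 2 := by
  have h1 : ∀ p : V × V, (A p.1 p.2 * ((d p.1 + s * d p.2) / 2)) ^ 2 ≤
      (1/2) * (A p.1 p.2 * d p.1 ^ 2) + (1/2) * (A p.2 p.1 * d p.2 ^ 2) := by
    intro p
    rw [hAs p.2 p.1]
    rcases hA p.1 p.2 with h | h <;> rw [h]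
    · simp
    · rcases hs with h3 | h3 <;> rw [h3] <;> nlinarith [sq_nonneg (d p.1 - d p.2), sq_nonneg (d p.1 + d p.2)]
  have h2 : ∑ u, ∑ v, (1/2) * (A u v * d u ^ 2) ≤ (1/2) * (D * ∑ u, d u ^ 2) := by
    rw [Finset.mul_sum, Finset.mul_sum]
    refine Finset.sum_le_sum fun u _ => ?_
    rw [← Finset.mul_sum, ← Finset.sum_mul]
    have := mul_le_mul_of_nonneg_right (hdeg u) (sq_nonneg (d u))
    linarith
  calc _ ≤ _ := Finset.sum_le_sum fun p _ => h1 p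
    _ = ∑ u, ∑ v, (1/2) * (A u v * d u ^ 2) + ∑ u, ∑ v, (1/2) * (A u v * d u ^ 2) := by
      rw [Finset.sum_add_distrib, Fintype.sum_prod_type, Fintype.sum_prod_type]
      congr 1
      rw [Finset.sum_comm]
    _ ≤ _ := by linarith

theorem hinfo_gen (A : V → V → ℝ) (hA : ∀ u v, A u v = 0 ∨ A u v = 1) (hAs : ∀ u v, A u v = A v u)
    (D : ℝ) (hD : 0 ≤ D) (hdeg : ∀ u, ∑ v, A u v ≤ D) (s : ℝ) (hs : s = 1 ∨ s = -1) (κ : ℝ)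
    (h0 : 0 ≤ κ) (h1 : κ < 1) (h2 : κ * Fintype.card (V × V) ≤ 1/2)
    (h3 : κ ^ 2 * (8 * 3 ^ Fintype.card (V × V)) ≤ 1) (M : V → V → ℝ) (K : ℝ) (hK0 : 0 < K)
    (hK : ∀ h u, ∑ v, |Dinf (wt M h) u (xs v)| ≤ 2 * K) (h : V → ℝ)
    (g : Conf V → ℝ) (hg : ∀ σ, 0 < g σ) :
      ∑ ξ, (∑ σ, g σ * ker (bE A s) κ σ ξ) * Real.log ((∑ σ, g σ * ker (bE A s) κ σ ξ) /
        ∑ σ, wt M h σ * ker (bE A s) κ σ ξ) -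
        (∑ σ, g σ) * Real.log ((∑ σ, g σ) / ∑ σ, wt M h σ) ≤
      κ ^ 2 * (2 * (2 * D * K) + 1) * Lf g (wt M h) := by
  set w := wt M h with hwdef
  have hw : ∀ σ, 0 < w σ := wt_pos M h
  have hG : 0 < ∑ σ, g σ := Finset.sum_pos (fun i _ => hg i) Finset.univ_nonempty
  have hW : 0 < ∑ σ, w σ := Finset.sum_pos (fun i _ => hw i) Finset.univ_nonempty
  set G := ∑ σ, g σ with hGd
  set W := ∑ σ, w σ with hWd
  set ν : Conf V → ℝ := fun σ => G⁻¹ * g σ with hν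
  set μ : Conf V → ℝ := fun σ => W⁻¹ * w σ with hμ
  have hGi : 0 < G⁻¹ := inv_pos.mpr hG
  have hWi : 0 < W⁻¹ := inv_pos.mpr hW
  have hνp : ∀ σ, 0 < ν σ := fun σ => mul_pos hGi (hg σ)
  have hμp : ∀ σ, 0 < μ σ := fun σ => mul_pos hWi (hw σ)
  have hν1 : ∑ σ, ν σ = 1 := by rw [hν, ← Finset.mul_sum]; exact inv_mul_cancel₀ hG.ne'
  have hμ1 : ∑ σ, μ σ = 1 := by rw [hμ, ← Finset.mul_sum]; exact inv_mul_cancel₀ hW.ne'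
  have hLν : Lf ν w = G⁻¹ * Lf g w := Lf_smul_left g w hg hw _ hGi
  have hLμ : Lf ν μ = Lf ν w := Lf_smul_right ν w hνp hw _ hWi
  have hes := ent_stab M K hK0 hK h ν hνp hν1
  rw [← hwdef] at hes
  set d : V → ℝ := fun u => ∑ σ, ν σ * xs u σ - Ex w (xs u) with hd
  have hd' : ∀ u, ∑ σ, (ν σ - μ σ) * xs u σ = d u := by
    intro u
    simp only [sub_mul, Finset.sum_sub_distrib, hd]
    congr 1
    simp only [hμ, Ex]
    rw [div_eq_inv_mul, Finset.mul_sum]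
    exact Finset.sum_congr rfl fun σ _ => by ring
  have hES : ∑ i, (∑ σ, (ν σ - μ σ) * bE A s i σ) ^ 2 ≤ (2 * D * K) * Lf ν μ := by
    have e : ∀ i : V × V, ∑ σ, (ν σ - μ σ) * bE A s i σ = A i.1 i.2 * ((d i.1 + s * d i.2) / 2) := by
      intro i
      rw [← hd', ← hd']
      simp only [bE, Finset.mul_sum, ← Finset.sum_add_distrib, Finset.sum_div]
      exact Finset.sum_congr rfl fun σ _ => by ring
    simp only [e]
    refine (es_pairs A hA hAs D hdeg s hs d).trans ?_
    rw [hLμ]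
    nlinarith [mul_le_mul_of_nonneg_left hes hD]
  have hI := info (bE A s) κ h0 h1 h2 h3 (bE_abs A hA s hs) ν μ hνp hμp hν1 hμ1 _ hES
  set k := ker (bE A s) κ with hk
  have hkp : ∀ σ ξ, 0 < k σ ξ := ker_pos (bE A s) κ h0 h1 (bE_abs A hA s hs)
  have hGk : ∀ ξ, 0 < ∑ σ, g σ * k σ ξ := fun ξ => Finset.sum_pos (fun σ _ => mul_pos (hg σ) (hkp σ ξ)) Finset.univ_nonempty
  have hWk : ∀ ξ, 0 < ∑ σ, w σ * k σ ξ := fun ξ => Finset.sum_pos (fun σ _ => mul_pos (hw σ) (hkp σ ξ)) Finset.univ_nonempty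
  have hsum : ∑ ξ, ∑ σ, g σ * k σ ξ = G := by
    rw [Finset.sum_comm]
    simp only [← Finset.mul_sum, hk, ker_sum, mul_one]
    rfl
  have e1 : ∀ ξ, (∑ σ, ν σ * k σ ξ) * Real.log ((∑ σ, ν σ * k σ ξ) / ∑ σ, μ σ * k σ ξ) =
      G⁻¹ * ((∑ σ, g σ * k σ ξ) * Real.log ((∑ σ, g σ * k σ ξ) / ∑ σ, w σ * k σ ξ)) -
      G⁻¹ * (Real.log (G / W) * (∑ σ, g σ * k σ ξ)) := by
    intro ξ
    have a1 : ∑ σ, ν σ * k σ ξ = G⁻¹ * ∑ σ, g σ * k σ ξ := by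
      rw [Finset.mul_sum]; exact Finset.sum_congr rfl fun σ _ => by simp only [hν]; ring
    have a2 : ∑ σ, μ σ * k σ ξ = W⁻¹ * ∑ σ, w σ * k σ ξ := by
      rw [Finset.mul_sum]; exact Finset.sum_congr rfl fun σ _ => by simp only [hμ]; ring
    have a3 : (∑ σ, ν σ * k σ ξ) / ∑ σ, μ σ * k σ ξ =
        ((∑ σ, g σ * k σ ξ) / ∑ σ, w σ * k σ ξ) / (G / W) := by
      rw [a1, a2]
      have := (hWk ξ).ne'
      field_simp
    rw [a3, Real.log_div (div_pos (hGk ξ) (hWk ξ)).ne' (div_pos hG hW).ne', a1]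
    ring
  simp only [e1] at hI
  rw [Finset.sum_sub_distrib, ← Finset.mul_sum, ← Finset.mul_sum, ← Finset.mul_sum, hsum, hLμ, hLν] at hI
  have hI2 := mul_le_mul_of_nonneg_left hI hG.le
  have c1 : G * G⁻¹ = 1 := mul_inv_cancel₀ hG.ne'
  calc _ = G * (G⁻¹ * ∑ ξ, (∑ σ, g σ * k σ ξ) * Real.log ((∑ σ, g σ * k σ ξ) / ∑ σ, w σ * k σ ξ) -
        G⁻¹ * (Real.log (G / W) * G)) := by
        rw [mul_sub, ← mul_assoc, ← mul_assoc, c1]; ring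
    _ ≤ _ := hI2
    _ = (G * G⁻¹) * (κ ^ 2 * (2 * (2 * D * K) + 1) * Lf g w) := by ring
    _ = _ := by rw [c1, one_mul]

theorem edge_exp (κ a x y z : ℝ) (h0 : 0 ≤ κ) (h1 : κ < 1) (ha : Real.log (1 + κ) + Real.log (1 - κ) = -2 * a)
    (hx : x = 1 ∨ x = -1) (hy : y = 1 ∨ y = -1) (hz : z = 1 ∨ z = -1) :
    1 + κ * z * ((x + y) / 2) = Real.exp ((Real.log (1 + κ) - Real.log (1 - κ)) / 4 * z * (x + y) -
      a / 2 * (1 + x * y)) := by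
  have e1 : Real.exp (Real.log (1 + κ)) = 1 + κ := Real.exp_log (by linarith)
  have e2 : Real.exp (Real.log (1 - κ)) = 1 - κ := Real.exp_log (by linarith)
  have key : ∀ E : ℝ, (E = Real.log (1 + κ) → Real.exp E = 1 + κ) ∧ (E = Real.log (1 - κ) → Real.exp E = 1 - κ)
      ∧ (E = 0 → Real.exp E = 1) := by
    intro E
    refine ⟨?_, ?_, ?_⟩
    · rintro rfl; exact e1
    · rintro rfl; exact e2
    · rintro rfl; exact Real.exp_zero
  rcases hx with rfl | rfl <;> rcases hy with rfl | rfl <;> rcases hz with rfl | rfl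
  · rw [(key _).1 (by linarith)]; ring
  · rw [(key _).2.1 (by linarith)]; ring
  · rw [(key _).2.2 (by linarith)]; ring
  · rw [(key _).2.2 (by linarith)]; ring
  · rw [(key _).2.2 (by linarith)]; ring
  · rw [(key _).2.2 (by linarith)]; ring
  · rw [(key _).2.1 (by linarith)]; ring
  · rw [(key _).1 (by linarith)]; ring

theorem sg_cases (b : Bool) : sg b = 1 ∨ sg b = -1 := by cases b <;> simp [sg]

theorem tilt (A : V → V → ℝ) (hA : ∀ u v, A u v = 0 ∨ A u v = 1)
    (s : ℝ) (hs : s = 1 ∨ s = -1) (κ a : ℝ) (h0 : 0 ≤ κ) (h1 : κ < 1)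
    (ha : Real.log (1 + κ) + Real.log (1 - κ) = -2 * a) (m : ℝ) (h : V → ℝ) (ξ : V × V → Bool) :
    ∃ c : ℝ, ∃ h' : V → ℝ, 0 < c ∧ ∀ σ,
      wt (fun u v => m * A u v) h σ * ker (bE A s) κ σ ξ =
        c * wt (fun u v => (m - s * a) * A u v) h' σ := by
  set ℓ := (Real.log (1 + κ) - Real.log (1 - κ)) / 4 with hℓ
  refine ⟨(1/2) ^ (Fintype.card (V × V)) * Real.exp (-(a / 2) * ∑ p : V × V, A p.1 p.2),
    fun u => h u + (∑ v, ℓ * A u v * sg (ξ (u, v)) + ∑ v, ℓ * s * A v u * sg (ξ (v, u))), by positivity, ?_⟩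
  intro σ
  have e1 : ∀ p : V × V, (1/2) * (1 + κ * sg (ξ p) * bE A s p σ) = (1/2) *
      Real.exp (A p.1 p.2 * (ℓ * sg (ξ p) * (xs p.1 σ + s * xs p.2 σ) - a / 2 * (1 + xs p.1 σ * (s * xs p.2 σ)))) := by
    intro p
    congr 1
    unfold bE
    rcases hA p.1 p.2 with h | h <;> rw [h]
    · simp
    · rw [one_mul, one_mul]
      refine edge_exp κ a _ _ _ h0 h1 ha (xs_cases _ _) ?_ (sg_cases _)
      rcases hs with h3 | h3 <;> rcases xs_cases p.2 σ with h4 | h4 <;> rw [h3, h4] <;> norm_num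
  unfold ker
  simp only [e1]
  rw [Finset.prod_mul_distrib, Finset.prod_const, Finset.card_univ, ← Real.exp_sum]
  unfold wt
  have e2 : ∀ x y z c : ℝ, x * (c * y) = c * (x * y) := by intros; ring
  rw [mul_assoc, e2 _ _ 0, ← Real.exp_add, ← Real.exp_add]
  congr 2
  rw [Fintype.sum_prod_type, Fintype.sum_prod_type]
  simp only [add_mul, Finset.sum_add_distrib, Finset.sum_mul]
  have e3 : ∑ x, ∑ i, ℓ * s * A i x * sg (ξ (i, x)) * sg (σ x) =
    ∑ x, ∑ i, ℓ * s * A x i * sg (ξ (x, i)) * sg (σ i) := by rw [Finset.sum_comm]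
  rw [e3]
  rw [Finset.mul_sum, Finset.mul_sum, Finset.mul_sum]
  simp only [Finset.mul_sum]
  have : ∀ P Q R S T U X : ℝ, P + R = S + T + U + X → (P + Q) + R = S + (T + (Q + (U + X))) := by
    intros; linarith
  apply this
  simp only [← Finset.sum_add_distrib]
  refine Finset.sum_congr rfl fun u _ => Finset.sum_congr rfl fun v _ => ?_
  simp only [xs]
  ring

theorem AT_mono (w : Conf V → ℝ) (hw : ∀ σ, 0 < w σ) (C C' : ℝ) (hC : 0 < C) (hCC : C ≤ C') (h : AT w C) :
    AT w C' := by
  intro g hg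
  have h1 := h g hg
  have h2 := Lf_nonneg g w hg hw
  have h3 : 0 ≤ ∑ v, Dv v g w := by
    by_contra hc
    push Not at hc
    have := mul_neg_of_pos_of_neg hC hc
    linarith
  exact h1.trans (mul_le_mul_of_nonneg_right hCC h3)

theorem AT_zero [Nonempty V] (A : V → V → ℝ) (h : V → ℝ) : AT (wt (fun u v => 0 * A u v) h) 1 := by
  have hupd : ∀ v s σ, wt (fun u v => 0 * A u v) h (Function.update σ v s) = Real.exp (h v * sg s) *
      wt (Mz (fun u v => 0 * A u v) v) (Function.update h v 0) σ := by
    intro v s σ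
    rw [wt_update _ (by simp) (by simp)]
    congr 2
    funext a; simp
  refine AT_prod _ (wt_pos _ _) (fun v b => Real.exp (h v * sg b) / (Real.exp (h v * sg true) + Real.exp (h v * sg false)))
    (fun v b => by positivity) ?_
  intro v σ
  unfold Sv
  rw [hupd, hupd]
  have := hupd v (σ v) σ
  rw [Function.update_eq_self] at this
  rw [this]
  have : 0 < Real.exp (h v * sg true) + Real.exp (h v * sg false) := by positivity
  field_simp

theorem AT_main [Nonempty V] (A : V → V → ℝ) (hA : ∀ u v, A u v = 0 ∨ A u v = 1) (hAs : ∀ u v, A u v = A v u)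
    (D : ℝ) (hD : 0 ≤ D) (hdeg : ∀ u, ∑ v, A u v ≤ D) (K J : ℝ) (hK0 : 0 < K)
    (hK : ∀ m, |m| ≤ J → ∀ h u, ∑ v, |Dinf (wt (fun u v => m * A u v) h) u (xs v)| ≤ 2 * K)
    (m : ℝ) (hm : |m| ≤ J) (h : V → ℝ) :
    AT (wt (fun u v => m * A u v) h) (Real.exp (4 * (2 * (2 * D * K) + 1) * |m|)) := by
  obtain ⟨s, hs, hsm⟩ : ∃ s : ℝ, (s = 1 ∨ s = -1) ∧ m = s * |m| := by
    rcases le_total 0 m with h | h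
    · exact ⟨1, Or.inl rfl, by rw [abs_of_nonneg h, one_mul]⟩
    · exact ⟨-1, Or.inr rfl, by rw [abs_of_nonpos h]; ring⟩
  set n := Fintype.card (V × V) with hn
  set B := 2 * (2 * D * K) + 1 with hB
  have hB1 : 1 ≤ B := by rw [hB]; nlinarith [mul_nonneg hD hK0.le]
  set Q : ℝ := 4 * (n:ℝ) ^ 2 + 8 * 3 ^ n + 2 * B with hQ
  have hQ1 : 8 ≤ Q := by
    have h1 : (1:ℝ) ≤ 3 ^ n := one_le_pow₀ (by norm_num)
    have h2 : (0:ℝ) ≤ (n:ℝ) ^ 2 := sq_nonneg _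
    rw [hQ]; linarith
  obtain ⟨N, hN⟩ := exists_nat_gt (2 * |m| * Q)
  have hN0 : 0 < (N:ℝ) := lt_of_le_of_lt (by positivity) hN
  set a := |m| / N with ha
  have ha0 : 0 ≤ a := by positivity
  have haQ : 2 * a * Q ≤ 1 := by
    rw [ha]
    have : 2 * (|m| / N) * Q = (2 * |m| * Q) / N := by ring
    rw [this, div_le_one hN0]; exact hN.le
  set κ := Real.sqrt (1 - Real.exp (-2 * a)) with hκ
  have hexp1 : Real.exp (-2 * a) ≤ 1 := Real.exp_le_one_iff.mpr (by linarith)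
  have hκ2 : κ ^ 2 = 1 - Real.exp (-2 * a) := Real.sq_sqrt (by linarith)
  have hκ0 : 0 ≤ κ := Real.sqrt_nonneg _
  have hκ1 : κ < 1 := by
    have := Real.exp_pos (-2 * a)
    nlinarith
  have hκa : κ ^ 2 ≤ 2 * a := by
    rw [hκ2]; linarith [Real.add_one_le_exp (-2 * a)]
  have hlog : Real.log (1 + κ) + Real.log (1 - κ) = -2 * a := by
    rw [← Real.log_mul (by linarith) (by linarith)]
    have : (1 + κ) * (1 - κ) = Real.exp (-2 * a) := by nlinarith
    rw [this, Real.log_exp]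
  have hκQ : κ ^ 2 * Q ≤ 1 := (mul_le_mul_of_nonneg_right hκa (by linarith)).trans haQ
  have hn2 : 0 ≤ (n:ℝ) ^ 2 := sq_nonneg _
  have h3n : (0:ℝ) ≤ 3 ^ n := by positivity
  have hκs : 0 ≤ κ ^ 2 := sq_nonneg _
  have c2 : κ * n ≤ 1 / 2 := by
    have : (κ * n) ^ 2 ≤ (1/2) ^ 2 := by
      have : κ ^ 2 * (4 * (n:ℝ) ^ 2) ≤ κ ^ 2 * Q := mul_le_mul_of_nonneg_left (by rw [hQ]; linarith) hκs
      nlinarith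
    exact (abs_le_of_sq_le_sq' this (by norm_num)).2
  have c3 : κ ^ 2 * (8 * 3 ^ n) ≤ 1 :=
    (mul_le_mul_of_nonneg_left (by rw [hQ]; linarith) hκs).trans hκQ
  set x := κ ^ 2 * B with hx
  have hx0 : 0 ≤ x := by positivity
  have hx2 : x ≤ 1/2 := by
    have : κ ^ 2 * (2 * B) ≤ κ ^ 2 * Q := mul_le_mul_of_nonneg_left (by rw [hQ]; linarith) hκs
    rw [hx]; linarith
  have hxa : x ≤ 2 * a * B := mul_le_mul_of_nonneg_right hκa (by linarith)
  have main : ∀ j : ℕ, j ≤ N → ∀ h, AT (wt (fun u v => (s * (a * j)) * A u v) h) (Real.exp (4 * B * a * j)) := by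
    intro j
    induction j with
    | zero => intro _ h; simpa using AT_zero A h
    | succ j ih =>
      intro hj h
      have hmj : |s * (a * ((j + 1 : ℕ):ℝ))| ≤ J := by
        rw [abs_mul, show |s| = 1 by rcases hs with h | h <;> rw [h] <;> norm_num, one_mul,
          abs_of_nonneg (by positivity)]
        refine le_trans ?_ hm
        rw [ha, div_mul_eq_mul_div, div_le_iff₀ hN0]
        exact mul_le_mul_of_nonneg_left (by exact_mod_cast hj) (abs_nonneg _)
      have hstep := AT_step (wt (fun u v => (s * (a * ((j + 1 : ℕ):ℝ))) * A u v) h) (wt_pos _ _)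
        (ker (bE A s) κ) (ker_pos _ κ hκ0 hκ1 (bE_abs A hA s hs)) (ker_sum _ κ)
        (Real.exp (4 * B * a * j)) x (Real.exp_pos _).le (by linarith) ?_ ?_
      · refine AT_mono _ (wt_pos _ _) _ _ (div_pos (Real.exp_pos _) (by linarith)) ?_ hstep
        rw [div_le_iff₀ (by linarith)]
        have : Real.exp (4 * B * a * ((j+1 : ℕ):ℝ)) = Real.exp (4 * B * a * j) * Real.exp (4 * B * a) := by
          rw [← Real.exp_add]; congr 1; push_cast; ring
        rw [this, mul_assoc (Real.exp _)]
        refine le_mul_of_one_le_right (Real.exp_pos _).le ?_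
        have e1 : 1 + 2 * x ≤ Real.exp (4 * B * a) :=
          le_trans (by nlinarith) (Real.add_one_le_exp (4 * B * a))
        calc (1:ℝ) ≤ (1 + 2 * x) * (1 - x) := by nlinarith
          _ ≤ _ := mul_le_mul_of_nonneg_right e1 (by linarith)
      · intro ξ
        obtain ⟨c, h', hc, he⟩ := tilt A hA s hs κ a hκ0 hκ1 hlog (s * (a * ((j + 1 : ℕ):ℝ))) h ξ
        rw [funext he]
        have e : s * (a * ((j + 1 : ℕ):ℝ)) - s * a = s * (a * j) := by push_cast; ring
        rw [e]
        exact AT_smul _ (wt_pos _ _) _ c hc (ih (by omega) h')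
      · intro g hg
        exact hinfo_gen A hA hAs D hD hdeg s hs κ hκ0 hκ1 c2 c3 _ K hK0 (hK _ hmj) h g hg
  have := main N le_rfl h
  have e : a * N = |m| := by rw [ha]; field_simp
  rw [mul_assoc (4 * B), e, ← hsm] at this
  exact this

end IsingAux

namespace IsingAux
variable {V : Type} [Fintype V] [DecidableEq V]

def monoG (G : SimpleGraph V) (σ : Conf V) : SimpleGraph V where
  Adj u v := G.Adj u v ∧ σ u = σ v
  symm := ⟨fun _ _ h => ⟨h.1.symm, h.2.symm⟩⟩
  loopless := ⟨fun u h => G.loopless.irrefl u h.1⟩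

theorem mono_sum (G : SimpleGraph V) (σ : Conf V) :
    ∑ u, ∑ v, (if G.Adj u v ∧ σ u = σ v then (1:ℝ) else 0) = 2 * monoCount G σ := by
  have h1 := (monoG G σ).sum_degrees_eq_twice_card_edges
  have h2 : (monoG G σ).edgeFinset.card = monoCount G σ := by
    unfold monoCount
    congr 1
    ext e
    simp only [SimpleGraph.mem_edgeFinset, Finset.mem_filter, Finset.mem_univ, true_and]
    induction e using Sym2.ind with
    | _ x y =>
      simp only [SimpleGraph.mem_edgeSet, Sym2.mem_iff, monoG]
      constructor
      · rintro ⟨h, h'⟩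
        refine ⟨h, ?_⟩
        rintro a (rfl | rfl) b (rfl | rfl) <;> simp [h']
      · rintro ⟨h, h'⟩
        exact ⟨h, h' x (Or.inl rfl) y (Or.inr rfl)⟩
  rw [h2] at h1
  have h3 : ∀ u, ∑ v, (if G.Adj u v ∧ σ u = σ v then (1:ℝ) else 0) = ((monoG G σ).degree u : ℝ) := by
    intro u
    rw [← SimpleGraph.card_neighborFinset_eq_degree, Finset.sum_boole]
    congr 2
    ext v
    simp only [Finset.mem_filter, Finset.mem_univ, true_and, SimpleGraph.mem_neighborFinset]
    rfl
  simp only [h3]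
  exact_mod_cast h1

def Ad (G : SimpleGraph V) (u v : V) : ℝ := if G.Adj u v then 1 else 0

theorem gibbs_num (G : SimpleGraph V) (β : ℝ) (hβ : 0 < β) (lam : V → ℝ) (hl : ∀ v, 0 < lam v) (σ : Conf V) :
    (β ^ monoCount G σ * ∏ v : V, if σ v then lam v else 1) =
    Real.exp ((1/4) * Real.log β * (∑ u, ∑ v, Ad G u v) + ∑ v, (1/2) * Real.log (lam v)) *
      wt (fun u v => (1/2 * Real.log β) * Ad G u v) (fun v => (1/2) * Real.log (lam v)) σ := by
  have e1 : β ^ monoCount G σ = Real.exp (Real.log β * monoCount G σ) := by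
    rw [mul_comm, Real.exp_nat_mul, Real.exp_log hβ]
  have e2 : (∏ v : V, if σ v then lam v else 1) = Real.exp (∑ v, (1/2) * Real.log (lam v) * (1 + sg (σ v))) := by
    rw [Real.exp_sum]
    refine Finset.prod_congr rfl fun v _ => ?_
    cases hv : σ v
    · simp [sg]
    · simp only [sg, if_true]
      rw [show (1/2:ℝ) * Real.log (lam v) * (1 + 1) = Real.log (lam v) by ring, Real.exp_log (hl v)]
  have e3 : (∑ u, ∑ v, Ad G u v) + ∑ u, ∑ v, Ad G u v * sg (σ u) * sg (σ v) = 4 * monoCount G σ := by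
    have := mono_sum G σ
    have h4 : ∑ u, ∑ v, 2 * (if G.Adj u v ∧ σ u = σ v then (1:ℝ) else 0) = 4 * monoCount G σ := by
      simp only [← Finset.mul_sum]; rw [this]; ring
    rw [← h4, ← Finset.sum_add_distrib]
    refine Finset.sum_congr rfl fun u _ => ?_
    rw [← Finset.sum_add_distrib]
    refine Finset.sum_congr rfl fun v _ => ?_
    unfold Ad
    by_cases h : G.Adj u v
    · cases σ u <;> cases σ v <;> simp [h, sg] <;> norm_num
    · simp [h]
  rw [e1, e2]
  unfold wt
  rw [← Real.exp_add, ← Real.exp_add]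
  congr 1
  have e4 : ∑ u, ∑ v, 1/2 * Real.log β * Ad G u v * sg (σ u) * sg (σ v) = 
      1/2 * Real.log β * ∑ u, ∑ v, Ad G u v * sg (σ u) * sg (σ v) := by
    simp only [Finset.mul_sum]
    exact Finset.sum_congr rfl fun u _ => Finset.sum_congr rfl fun v _ => by ring
  rw [e4]
  simp only [mul_add, mul_one, Finset.sum_add_distrib]
  have := congrArg (fun z => Real.log β * z / 4) e3
  linarith

theorem gibbs_eq (G : SimpleGraph V) (β : ℝ) (hβ : 0 < β) (lam : V → ℝ) (hl : ∀ v, 0 < lam v) :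
    ∃ c : ℝ, 0 < c ∧ isingGibbs G β lam = fun σ => c *
      wt (fun u v => (1/2 * Real.log β) * Ad G u v) (fun v => (1/2) * Real.log (lam v)) σ := by
  set w := wt (fun u v => (1/2 * Real.log β) * Ad G u v) (fun v => (1/2) * Real.log (lam v)) with hw
  have hW : 0 < ∑ σ, w σ := Finset.sum_pos (fun i _ => wt_pos _ _ _) Finset.univ_nonempty
  refine ⟨(∑ σ, w σ)⁻¹, inv_pos.mpr hW, ?_⟩
  funext σ
  unfold isingGibbs
  obtain ⟨c, hc, hcw⟩ : ∃ c : ℝ, 0 < c ∧ ∀ σ, (β ^ monoCount G σ * ∏ v : V, if σ v then lam v else 1) = c * w σ :=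
    ⟨_, Real.exp_pos _, gibbs_num G β hβ lam hl⟩
  simp only [hcw]
  rw [← Finset.mul_sum, mul_div_mul_left _ _ hc.ne', div_eq_inv_mul]

theorem gibbs_sum (G : SimpleGraph V) (β : ℝ) (hβ : 0 < β) (lam : V → ℝ) (hl : ∀ v, 0 < lam v) :
    ∑ σ, isingGibbs G β lam σ = 1 := by
  unfold isingGibbs
  rw [← Finset.sum_div, div_self]
  refine (Finset.sum_pos (fun σ _ => ?_) Finset.univ_nonempty).ne'
  rw [gibbs_num G β hβ lam hl]
  exact mul_pos (Real.exp_pos _) (wt_pos _ _ _)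

theorem tanh_bd (m b t : ℝ) (ht : 0 ≤ t) (hb : b - 1 ≤ t * (b + 1)) (ht1 : t ≤ 1) (hb0 : 0 < b)
    (hm : |m| ≤ 1/2 * Real.log b) :
    |Real.exp m - Real.exp (-m)| ≤ t * (Real.exp m + Real.exp (-m)) := by
  wlog h0 : 0 ≤ m generalizing m with H
  · have := H (-m) (by rwa [abs_neg]) (by linarith)
    rw [neg_neg, abs_sub_comm] at this
    linarith
  · rw [abs_of_nonneg h0] at hm
    have h1 : Real.exp (-m) ≤ Real.exp m := Real.exp_le_exp.mpr (by linarith)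
    rw [abs_of_nonneg (by linarith)]
    have h2 : Real.exp m * Real.exp m ≤ b := by
      rw [← Real.exp_add, ← Real.exp_log hb0]
      exact Real.exp_le_exp.mpr (by linarith)
    have h3 : Real.exp m * Real.exp (-m) = 1 := by rw [← Real.exp_add]; simp
    have h4 := Real.exp_pos m
    have h5 : (1 - t) * (Real.exp m * Real.exp m) ≤ 1 + t := by nlinarith
    have h6 : Real.exp m * (Real.exp m - Real.exp (-m) - t * (Real.exp m + Real.exp (-m))) ≤ 0 := by
      have : Real.exp m * (Real.exp m - Real.exp (-m) - t * (Real.exp m + Real.exp (-m))) =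
        (1 - t) * (Real.exp m * Real.exp m) - (1 + t) * (Real.exp m * Real.exp (-m)) := by ring
      rw [this, h3]; linarith
    by_contra hc
    push Not at hc
    have := mul_pos h4 (sub_pos.mpr hc)
    linarith

theorem model (G : SimpleGraph V) [DecidableRel G.Adj] [Nonempty V] (δ β : ℝ) (lam : V → ℝ)
    (hδ : 0 < δ) (hδ1 : δ < 1) (hΔ : 3 ≤ G.maxDegree)
    (hb1 : ((G.maxDegree : ℝ) - 2 + δ) / ((G.maxDegree : ℝ) - δ) ≤ β)
    (hb2 : β ≤ ((G.maxDegree : ℝ) - δ) / ((G.maxDegree : ℝ) - 2 + δ))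
    (hl : ∀ v, 0 < lam v) :
    (∃ c : ℝ, 0 < c ∧ ∃ (M : V → V → ℝ) (h : V → ℝ), (∀ u v, M u v = M v u) ∧ (∀ u, M u u = 0) ∧
      (∀ u, ∑ v, |M u v| ≤ 3) ∧ isingGibbs G β lam = fun σ => c * wt M h σ) ∧
    (∑ σ, isingGibbs G β lam σ = 1) ∧ AT (isingGibbs G β lam) (Real.exp (148 / δ)) := by
  set Δ : ℝ := (G.maxDegree : ℝ) with hΔd
  have h3 : (3:ℝ) ≤ Δ := by rw [hΔd]; exact_mod_cast hΔ
  have hβ : 0 < β := lt_of_lt_of_le (div_pos (by linarith) (by linarith)) hb1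
  set b := (Δ - δ) / (Δ - 2 + δ) with hb
  have hb0 : 0 < b := div_pos (by linarith) (by linarith)
  set m := 1/2 * Real.log β with hm
  have hmb : |m| ≤ 1/2 * Real.log b := by
    have l1 : Real.log β ≤ Real.log b := Real.log_le_log hβ hb2
    have l2 : - Real.log b ≤ Real.log β := by
      rw [← Real.log_inv]
      refine Real.log_le_log (inv_pos.mpr hb0) ?_
      rwa [hb, inv_div]
    rw [abs_le]; constructor <;> linarith
  have hbm : 1/2 * Real.log b ≤ 1 / (Δ - 2) := by
    have := Real.log_le_sub_one_of_pos hb0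
    have e : b - 1 = 2 * ((1 - δ) / (Δ - 2 + δ)) := by
      rw [hb]; have : Δ - 2 + δ ≠ 0 := by linarith
      field_simp; ring
    have : (1 - δ) / (Δ - 2 + δ) ≤ 1 / (Δ - 2) := by
      rw [div_le_div_iff₀ (by linarith) (by linarith)]; nlinarith
    linarith
  have hm1 : |m| ≤ 1 := by
    refine (hmb.trans hbm).trans ?_
    rw [div_le_one (by linarith)]; linarith
  have hm3 : Δ * |m| ≤ 3 := by
    calc Δ * |m| ≤ Δ * (1 / (Δ - 2)) := mul_le_mul_of_nonneg_left (hmb.trans hbm) (by linarith)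
      _ = Δ / (Δ - 2) := by ring
      _ ≤ 3 := by rw [div_le_iff₀ (by linarith)]; linarith
  have hA : ∀ u v, Ad G u v = 0 ∨ Ad G u v = 1 := by
    intro u v; unfold Ad; split_ifs <;> simp
  have hAs : ∀ u v, Ad G u v = Ad G v u := by
    intro u v; unfold Ad; by_cases h : G.Adj u v
    · simp [h, h.symm]
    · have h' : ¬ G.Adj v u := fun h' => h h'.symm
      simp [h, h']
  have hA0 : ∀ u, Ad G u u = 0 := by intro u; simp [Ad]
  have hcard : ∀ u, (Finset.univ.filter (fun v => G.Adj u v)).card ≤ G.maxDegree := by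
    intro u
    refine le_trans (le_of_eq ?_) (G.degree_le_maxDegree u)
    rw [← SimpleGraph.card_neighborFinset_eq_degree]
    congr 1
    ext v; simp
  have hdeg : ∀ u, ∑ v, Ad G u v ≤ Δ := by
    intro u
    have e : ∑ v, Ad G u v = ((Finset.univ.filter (fun v => G.Adj u v)).card : ℝ) := by
      rw [← Finset.sum_boole]
      refine Finset.sum_congr rfl fun v _ => ?_
      by_cases h : G.Adj u v <;> simp [Ad, h]
    rw [e, hΔd]
    exact_mod_cast hcard u
  set t := (1 - δ) / (Δ - 1) with ht
  have ht0 : 0 ≤ t := div_nonneg (by linarith) (by linarith)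
  have ht1 : t ≤ 1 := by rw [ht, div_le_one (by linarith)]; linarith
  have hbt : b - 1 ≤ t * (b + 1) := by
    refine le_of_eq ?_
    rw [hb, ht]
    have : Δ - 2 + δ ≠ 0 := by linarith
    have : Δ - 1 ≠ 0 := by linarith
    field_simp; ring
  obtain ⟨d, hd⟩ : ∃ d : ℕ, G.maxDegree = d + 1 := ⟨G.maxDegree - 1, by omega⟩
  have hdr : (d:ℝ) = Δ - 1 := by rw [hΔd, hd]; push_cast; ring
  set K := 1 + Δ * t / δ with hK
  have hK0 : 0 < K := by positivity
  have hK3 : K ≤ 3 / δ := by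
    have e1 : Δ * t ≤ 3/2 := by
      rw [ht, ← mul_div_assoc, div_le_iff₀ (by linarith)]; nlinarith
    rw [hK, le_div_iff₀ hδ, add_mul, div_mul_cancel₀ _ hδ.ne']
    linarith
  obtain ⟨c, hc, hceq⟩ := gibbs_eq G β hβ lam hl
  refine ⟨⟨c, hc, fun u v => m * Ad G u v, _, fun u v => by simp only [hAs u v], fun u => by simp only [hA0, mul_zero], ?_, hceq⟩,
    gibbs_sum G β hβ lam hl, ?_⟩
  · intro u
    have : ∀ v, |m * Ad G u v| = |m| * Ad G u v := by
      intro v; rw [abs_mul, abs_of_nonneg (a := Ad G u v)]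
      rcases hA u v with h | h <;> rw [h] <;> norm_num
    simp only [this]
    rw [← Finset.mul_sum]
    have := mul_le_mul_of_nonneg_left (hdeg u) (abs_nonneg m)
    linarith
  · rw [hceq]
    refine AT_smul _ (wt_pos _ _) _ c hc ?_
    have := AT_main (Ad G) hA hAs Δ (by linarith) hdeg K (1/2 * Real.log b) hK0 ?_ m hmb
      (fun v => (1/2) * Real.log (lam v))
    · refine AT_mono _ (wt_pos _ _) _ _ (Real.exp_pos _) ?_ this
      refine Real.exp_le_exp.mpr ?_
      have e1 : 4 * (2 * (2 * Δ * K) + 1) * |m| = 16 * K * (Δ * |m|) + 4 * |m| := by ring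
      rw [e1]
      have e2 : 16 * K * (Δ * |m|) ≤ 16 * (3 / δ) * 3 := by gcongr
      have e3 : 1 ≤ 1 / δ := by rw [le_div_iff₀ hδ]; linarith
      calc _ ≤ 16 * (3 / δ) * 3 + 4 * (1 / δ) := by linarith
        _ = _ := by ring
    · intro m' hm' h u
      have := dinf_all d t δ ht0 hδ (by rw [hdr, ht, mul_div_cancel₀ _ (by linarith)])
        (fun u v => m' * Ad G u v) (fun a b => by simp only [hAs a b]) (fun a => by simp only [hA0, mul_zero]) ?_ ?_ u h
      · rw [hdr, sub_add_cancel] at this; exact this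
      · intro x y
        rcases hA x y with h | h <;> simp only [h, mul_zero, mul_one]
        · simp; exact ht0
        · exact tanh_bd m' b t ht0 hbt ht1 hb0 hm'
      · intro x
        rw [← hd]
        refine le_trans (Finset.card_le_card ?_) (hcard x)
        intro y hy
        simp only [nb, Finset.mem_filter, Finset.mem_univ, true_and] at hy ⊢
        by_contra hc
        exact hy (by simp [Ad, hc])

end IsingAux

namespace IsingAux
variable {V : Type} [Fintype V] [DecidableEq V]

def Pg (μ g : Conf V → ℝ) (τ : Conf V) : ℝ := (Fintype.card V : ℝ)⁻¹ * ∑ v, Tv v μ g τ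

theorem agree_iff (v : V) (ρ σ : Conf V) : (∀ u ∈ Finset.univ.erase v, ρ u = σ u) ↔
    (ρ = Function.update σ v true ∨ ρ = Function.update σ v false) := by
  constructor
  · intro h
    rcases hb : ρ v with _ | _
    · right
      funext u
      by_cases hu : u = v
      · subst hu; simp [hb]
      · simp [hu, h u (by simp [hu])]
    · left
      funext u
      by_cases hu : u = v
      · subst hu; simp [hb]
      · simp [hu, h u (by simp [hu])]
  · rintro (h | h) u hu <;> subst h <;> simp at hu <;> simp [hu]

theorem agree_sum (v : V) (f : Conf V → ℝ) (σ : Conf V) :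
    (∑ ρ : Conf V, if ∀ u ∈ Finset.univ.erase v, ρ u = σ u then f ρ else 0) = Sv v f σ := by
  have hne : Function.update σ v true ≠ Function.update σ v false := by
    intro h
    have := congrFun h v
    simp at this
  have h1 : ∀ ρ : Conf V, (if ∀ u ∈ Finset.univ.erase v, ρ u = σ u then f ρ else 0) =
      (if ρ = Function.update σ v true then f ρ else 0) +
      (if ρ = Function.update σ v false then f ρ else 0) := by
    intro ρ
    simp only [agree_iff]
    by_cases h1 : ρ = Function.update σ v true
    · have h2 : ρ ≠ Function.update σ v false := by rw [h1]; exact hne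
      simp [h1, hne]
    · simp [h1]
  simp only [h1, Finset.sum_add_distrib, Finset.sum_ite_eq', Finset.mem_univ, if_true]
  rfl

theorem chain_step (μ ν : Conf V → ℝ) (t : ℕ) :
    chainDist μ ν (t + 1) = Pg μ (chainDist μ ν t) := by
  funext τ
  show (∑ σ : Conf V, chainDist μ ν t σ * glauber μ σ τ) = _
  set g := chainDist μ ν t
  have h1 : ∀ σ (v : V), condDist μ (Finset.univ.erase v) σ τ =
      if ∀ u ∈ Finset.univ.erase v, σ u = τ u then μ τ / Sv v μ τ else 0 := by
    intro σ v
    unfold condDist margin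
    rw [agree_sum v μ σ]
    by_cases h : ∀ u ∈ Finset.univ.erase v, τ u = σ u
    · have h' : ∀ u ∈ Finset.univ.erase v, σ u = τ u := fun u hu => (h u hu).symm
      rw [if_pos h, if_pos h']
      rcases (agree_iff v τ σ).1 h with e | e <;> rw [e, Sv_update]
    · have h' : ¬ ∀ u ∈ Finset.univ.erase v, σ u = τ u :=
        fun h2 => h (fun u hu => (h2 u hu).symm)
      rw [if_neg h, if_neg h']
  have h2 : ∀ σ, g σ * glauber μ σ τ = (Fintype.card V : ℝ)⁻¹ * ∑ v : V,
      (if ∀ u ∈ Finset.univ.erase v, σ u = τ u then g σ else 0) * (μ τ / Sv v μ τ) := by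
    intro σ
    unfold glauber
    simp only [h1]
    rw [mul_left_comm, Finset.mul_sum]
    congr 1
    refine Finset.sum_congr rfl fun v _ => ?_
    split_ifs <;> simp
  simp only [h2]
  rw [← Finset.mul_sum, Finset.sum_comm]
  unfold Pg
  congr 1
  refine Finset.sum_congr rfl fun v _ => ?_
  rw [← Finset.sum_mul, agree_sum]
  unfold Tv; ring

theorem chain_iter (μ ν : Conf V → ℝ) (t s : ℕ) :
    chainDist μ ν (t + s) = (Pg μ)^[s] (chainDist μ ν t) := by
  induction s with
  | zero => rfl
  | succ s ih =>
    rw [← add_assoc, chain_step, ih, Function.iterate_succ_apply']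

theorem Tv_sub (v : V) (μ f g : Conf V → ℝ) (σ : Conf V) :
    Tv v μ (fun σ => f σ - g σ) σ = Tv v μ f σ - Tv v μ g σ := by
  unfold Tv Sv; ring

theorem Tv_add (v : V) (μ f g : Conf V → ℝ) (σ : Conf V) :
    Tv v μ (fun σ => f σ + g σ) σ = Tv v μ f σ + Tv v μ g σ := by
  unfold Tv Sv; ring

theorem Pg_sub (μ f g : Conf V → ℝ) (σ : Conf V) :
    Pg μ (fun σ => f σ - g σ) σ = Pg μ f σ - Pg μ g σ := by
  unfold Pg; simp only [Tv_sub, Finset.sum_sub_distrib]; ring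

theorem Tv_nonneg (v : V) (μ f : Conf V → ℝ) (hμ : ∀ σ, 0 < μ σ) (hf : ∀ σ, 0 ≤ f σ) (σ : Conf V) :
    0 ≤ Tv v μ f σ :=
  mul_nonneg (hμ σ).le (div_nonneg (add_nonneg (hf _) (hf _)) (Sv_pos v μ hμ σ).le)

theorem Tv_abs (v : V) (μ f : Conf V → ℝ) (hμ : ∀ σ, 0 < μ σ) (σ : Conf V) :
    |Tv v μ f σ| ≤ Tv v μ (fun σ => |f σ|) σ := by
  unfold Tv
  rw [abs_mul, abs_div, abs_of_pos (hμ σ), abs_of_pos (Sv_pos v μ hμ σ)]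
  refine mul_le_mul_of_nonneg_left ?_ (hμ σ).le
  refine div_le_div_of_nonneg_right ?_ (Sv_pos v μ hμ σ).le
  exact abs_add_le _ _

theorem sum_Pg [Nonempty V] (μ g : Conf V → ℝ) (hμ : ∀ σ, 0 < μ σ) : ∑ σ, Pg μ g σ = ∑ σ, g σ := by
  unfold Pg
  have hn : (Fintype.card V : ℝ) ≠ 0 := by simp
  rw [← Finset.mul_sum, Finset.sum_comm]
  simp only [sum_Tv _ _ _ hμ]
  rw [Finset.sum_const, Finset.card_univ, nsmul_eq_mul]
  field_simp

theorem Pg_pos [Nonempty V] (μ g : Conf V → ℝ) (hμ : ∀ σ, 0 < μ σ) (hg : ∀ σ, 0 < g σ) (σ : Conf V) :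
    0 < Pg μ g σ := by
  unfold Pg
  have hn : (0:ℝ) < (Fintype.card V : ℝ) := by exact_mod_cast Fintype.card_pos
  exact mul_pos (inv_pos.2 hn) (Finset.sum_pos (fun v _ => Tv_pos v g μ hg hμ σ) Finset.univ_nonempty)

theorem Pg_l1 [Nonempty V] (μ f : Conf V → ℝ) (hμ : ∀ σ, 0 < μ σ) :
    ∑ σ, |Pg μ f σ| ≤ ∑ σ, |f σ| := by
  rw [← sum_Pg μ (fun σ => |f σ|) hμ]
  refine Finset.sum_le_sum fun σ _ => ?_
  unfold Pg
  rw [abs_mul, abs_of_nonneg (by positivity : (0:ℝ) ≤ (Fintype.card V : ℝ)⁻¹)]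
  refine mul_le_mul_of_nonneg_left ?_ (by positivity)
  exact (Finset.abs_sum_le_sum_abs _ _).trans (Finset.sum_le_sum fun v _ => Tv_abs v μ f hμ σ)

theorem iter_l1 [Nonempty V] (μ f g : Conf V → ℝ) (hμ : ∀ σ, 0 < μ σ) (t : ℕ) :
    ∑ σ, |(Pg μ)^[t] f σ - (Pg μ)^[t] g σ| ≤ ∑ σ, |f σ - g σ| := by
  induction t with
  | zero => exact le_rfl
  | succ t ih =>
    simp only [Function.iterate_succ_apply', ← Pg_sub]
    exact (Pg_l1 μ _ hμ).trans ih

theorem Pg_kl [Nonempty V] (μ g : Conf V → ℝ) (hμ : ∀ σ, 0 < μ σ) (hg : ∀ σ, 0 < g σ) (C : ℝ)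
    (hC : 0 < C) (h : AT μ C) :
    Lf (Pg μ g) μ ≤ (1 - 1 / (Fintype.card V * C)) * Lf g μ := by
  have hn : (0:ℝ) < (Fintype.card V : ℝ) := by exact_mod_cast Fintype.card_pos
  set n : ℝ := (Fintype.card V : ℝ) with hnd
  have hc : ∀ (x : ℝ), ∑ _v : V, x = n * x := by
    intro x; rw [Finset.sum_const, Finset.card_univ, nsmul_eq_mul]
  have h1 : ∀ σ, Pg μ g σ * Real.log (Pg μ g σ / μ σ) ≤
      n⁻¹ * ∑ v, Tv v μ g σ * Real.log (Tv v μ g σ / μ σ) := by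
    intro σ
    have := log_sum Finset.univ (fun v => Tv v μ g σ) (fun _ => μ σ)
      (fun v _ => Tv_pos v g μ hg hμ σ) (fun v _ => hμ σ)
    rw [hc] at this
    have e : (∑ v, Tv v μ g σ) / (n * μ σ) = Pg μ g σ / μ σ := by
      unfold Pg; rw [← hnd]; have := (hμ σ).ne'; field_simp
    rw [e] at this
    have := mul_le_mul_of_nonneg_left this (inv_pos.2 hn).le
    rw [← mul_assoc] at this
    exact this
  have h2 : Lf (Pg μ g) μ ≤ n⁻¹ * ∑ v, Lf (Tv v μ g) μ := by
    unfold Lf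
    rw [sum_Pg μ g hμ]
    simp only [sum_Tv _ _ _ hμ]
    rw [Finset.sum_sub_distrib, hc, mul_sub, ← mul_assoc, ← mul_assoc, inv_mul_cancel₀ hn.ne', one_mul]
    refine sub_le_sub_right ?_ _
    rw [Finset.sum_comm, Finset.mul_sum]
    exact Finset.sum_le_sum fun σ _ => h1 σ
  simp only [Lf_Tv _ _ _ hμ] at h2
  rw [Finset.sum_sub_distrib, hc, mul_sub, ← mul_assoc, inv_mul_cancel₀ hn.ne', one_mul] at h2
  have h3 := h g hg
  have h4 : (1 / (n * C)) * Lf g μ ≤ n⁻¹ * ∑ v, Dv v g μ := by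
    calc (1 / (n * C)) * Lf g μ ≤ (1 / (n * C)) * (C * ∑ v, Dv v g μ) :=
          mul_le_mul_of_nonneg_left h3 (by positivity)
      _ = _ := by field_simp
  linarith

theorem iter_kl [Nonempty V] (μ g : Conf V → ℝ) (hμ : ∀ σ, 0 < μ σ) (hg : ∀ σ, 0 < g σ) (C : ℝ)
    (hC : 0 < C) (h : AT μ C) (t : ℕ) :
    (∀ σ, 0 < (Pg μ)^[t] g σ) ∧ ∑ σ, (Pg μ)^[t] g σ = ∑ σ, g σ ∧
    Lf ((Pg μ)^[t] g) μ ≤ Real.exp (-(t / (Fintype.card V * C))) * Lf g μ := by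
  induction t with
  | zero => simp [hg]
  | succ t ih =>
    obtain ⟨h1, h2, h3⟩ := ih
    simp only [Function.iterate_succ_apply']
    refine ⟨Pg_pos μ _ hμ h1, by rw [sum_Pg _ _ hμ, h2], ?_⟩
    refine (Pg_kl μ _ hμ h1 C hC h).trans ?_
    have h4 : 1 - 1 / (Fintype.card V * C) ≤ Real.exp (-(1 / (Fintype.card V * C))) := by
      have := Real.add_one_le_exp (-(1 / (Fintype.card V * C)))
      linarith
    calc _ ≤ Real.exp (-(1 / (Fintype.card V * C))) * Lf ((Pg μ)^[t] g) μ :=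
          mul_le_mul_of_nonneg_right h4 (Lf_nonneg _ _ h1 hμ)
      _ ≤ Real.exp (-(1 / (Fintype.card V * C))) * (Real.exp (-(t / (Fintype.card V * C))) * Lf g μ) :=
          mul_le_mul_of_nonneg_left h3 (Real.exp_pos _).le
      _ = _ := by
          rw [← mul_assoc, ← Real.exp_add]
          congr 2
          push_cast; ring

end IsingAux

namespace IsingAux
variable {V : Type} [Fintype V] [DecidableEq V]

def Bd (p : V → Bool → ℝ) (A : Finset V) (g : Conf V → ℝ) : Prop :=
  ∀ B ⊆ A, ∀ τ : Conf V, margin g B τ ≤ (∑ σ, g σ) * ∏ u ∈ B, p u (τ u)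

theorem margin_eq (g : Conf V → ℝ) (B : Finset V) (τ : Conf V) :
    margin g B τ = ∑ σ, g σ * (if ∀ u ∈ B, σ u = τ u then 1 else 0) := by
  unfold margin
  refine Finset.sum_congr rfl fun σ _ => ?_
  split_ifs <;> simp

theorem ind_update (v : V) (B : Finset V) (hv : v ∉ B) (τ σ : Conf V) (b : Bool) :
    (if ∀ u ∈ B, (Function.update σ v b) u = τ u then (1:ℝ) else 0) =
      if ∀ u ∈ B, σ u = τ u then 1 else 0 := by
  have : (∀ u ∈ B, (Function.update σ v b) u = τ u) ↔ ∀ u ∈ B, σ u = τ u := by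
    refine forall₂_congr fun u hu => ?_
    have : u ≠ v := fun h => hv (h ▸ hu)
    simp [this]
  simp only [this]

theorem half_sum (v : V) (b : Bool) (F : Conf V → ℝ) (hF : ∀ σ c, F (Function.update σ v c) = F σ) :
    2 * ∑ σ : Conf V, (if σ v = b then F σ else 0) = ∑ σ, F σ := by
  rw [← sum_Sv v (fun σ : Conf V => if σ v = b then F σ else 0)]
  refine Finset.sum_congr rfl fun σ _ => ?_
  unfold Sv
  simp only [hF, Function.update_self]
  cases b <;> simp

theorem Bd_step (p : V → Bool → ℝ) (hp : ∀ v b, 0 ≤ p v b) (μ : Conf V → ℝ) (hμ : ∀ σ, 0 < μ σ)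
    (hpm : ∀ v σ, μ σ ≤ p v (σ v) * Sv v μ σ) (A : Finset V) (g : Conf V → ℝ) (hg : ∀ σ, 0 ≤ g σ)
    (v : V) (h : Bd p A g) : Bd p (insert v A) (Tv v μ g) := by
  intro B hB τ
  rw [sum_Tv v g μ hμ]
  by_cases hv : v ∈ B
  · have hB' : B.erase v ⊆ A := by
      intro u hu
      rw [Finset.mem_erase] at hu
      rcases Finset.mem_insert.1 (hB hu.2) with h1 | h1
      · exact absurd h1 hu.1
      · exact h1
    have h1 := h _ hB' τ
    set φ : Conf V → ℝ := fun σ => if ∀ u ∈ B.erase v, σ u = τ u then 1 else 0 with hφ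
    have hφu : ∀ σ b, φ (Function.update σ v b) = φ σ := fun σ b =>
      ind_update v (B.erase v) (Finset.notMem_erase v B) τ σ b
    have hφ0 : ∀ σ, 0 ≤ φ σ := fun σ => by simp only [hφ]; split_ifs <;> simp
    have h2 : margin (Tv v μ g) B τ ≤
        p v (τ v) * ∑ σ : Conf V, (if σ v = τ v then Sv v g σ * φ σ else 0) := by
      rw [margin_eq, Finset.mul_sum]
      refine Finset.sum_le_sum fun σ _ => ?_
      have e : (if ∀ u ∈ B, σ u = τ u then (1:ℝ) else 0) = if σ v = τ v then φ σ else 0 := by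
        by_cases hs : σ v = τ v
        · have : (∀ u ∈ B, σ u = τ u) ↔ ∀ u ∈ B.erase v, σ u = τ u := by
            constructor
            · intro h u hu; exact h u (Finset.mem_of_mem_erase hu)
            · intro h u hu
              by_cases huv : u = v
              · rw [huv, hs]
              · exact h u (Finset.mem_erase.2 ⟨huv, hu⟩)
          simp only [this, hs, if_true, hφ]
        · have : ¬ ∀ u ∈ B, σ u = τ u := fun h => hs (h v hv)
          rw [if_neg this, if_neg hs]
      rw [e]
      by_cases hs : σ v = τ v
      · rw [if_pos hs, if_pos hs, ← mul_assoc]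
        refine mul_le_mul_of_nonneg_right ?_ (hφ0 σ)
        unfold Tv
        have hS := Sv_pos v μ hμ σ
        have hS' : 0 ≤ Sv v g σ := add_nonneg (hg _) (hg _)
        have h3 := hpm v σ
        rw [hs] at h3
        rw [← mul_div_assoc, div_le_iff₀ hS]
        nlinarith [mul_le_mul_of_nonneg_right h3 hS']
      · simp [hs]
    have h3 : ∑ σ : Conf V, (if σ v = τ v then Sv v g σ * φ σ else 0) = margin g (B.erase v) τ := by
      have h4 := half_sum v (τ v) (fun σ => Sv v g σ * φ σ) (fun σ c => by rw [Sv_update, hφu])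
      have h5 : ∑ σ, Sv v g σ * φ σ = 2 * ∑ σ, g σ * φ σ := by
        rw [← sum_Sv v (fun σ => g σ * φ σ)]
        exact Finset.sum_congr rfl fun σ _ => (Sv_mul v g φ hφu σ).symm
      rw [margin_eq]
      linarith
    rw [h3] at h2
    rw [← Finset.mul_prod_erase B (fun u => p u (τ u)) hv]
    calc _ ≤ _ := h2
      _ ≤ _ := mul_le_mul_of_nonneg_left h1 (hp _ _)
      _ = _ := by ring
  · have hB' : B ⊆ A := by
      intro u hu
      rcases Finset.mem_insert.1 (hB hu) with h1 | h1
      · exact absurd (h1 ▸ hu) hv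
      · exact h1
    have h1 := h _ hB' τ
    rw [margin_eq] at h1 ⊢
    rw [sum_Tv_mul v g μ _ hμ (fun σ b => ind_update v B hv τ σ b)]
    exact h1

theorem Bd_sum {ι : Type*} (s : Finset ι) (p : V → Bool → ℝ) (A : Finset V) (f : ι → Conf V → ℝ)
    (h : ∀ i ∈ s, Bd p A (f i)) : Bd p A (fun σ => ∑ i ∈ s, f i σ) := by
  intro B hB τ
  rw [margin_eq]
  simp only [Finset.sum_mul]
  rw [Finset.sum_comm, Finset.sum_comm (s := Finset.univ)]
  refine Finset.sum_le_sum fun i hi => ?_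
  have := h i hi B hB τ
  rw [margin_eq, Finset.sum_mul] at this
  exact this

theorem Bd_smul (p : V → Bool → ℝ) (A : Finset V) (f : Conf V → ℝ) (c : ℝ) (hc : 0 ≤ c)
    (h : Bd p A f) : Bd p A (fun σ => c * f σ) := by
  intro B hB τ
  rw [margin_eq]
  simp only [mul_assoc]
  rw [← Finset.mul_sum, ← Finset.mul_sum, mul_assoc]
  have := h B hB τ
  rw [margin_eq] at this
  exact mul_le_mul_of_nonneg_left this hc

theorem Bd_zero (p : V → Bool → ℝ) (A : Finset V) : Bd p A (fun _ => 0) := by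
  intro B hB τ
  simp [margin]

theorem dec [Nonempty V] (p : V → Bool → ℝ) (hp : ∀ v b, 0 ≤ p v b) (μ : Conf V → ℝ)
    (hμ : ∀ σ, 0 < μ σ) (hpm : ∀ v σ, μ σ ≤ p v (σ v) * Sv v μ σ) (ν : Conf V → ℝ)
    (hν : ∀ σ, 0 ≤ ν σ) (hν1 : ∑ σ, ν σ = 1) (t : ℕ) :
    ∃ a : Finset V → Conf V → ℝ, (∀ A σ, 0 ≤ a A σ) ∧
      (∀ σ, chainDist μ ν t σ = ∑ A, a A σ) ∧ (∀ A, Bd p A (a A)) ∧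
      ∀ w, ∑ A, (if w ∈ A then 0 else ∑ σ, a A σ) ≤ (1 - 1 / (Fintype.card V : ℝ)) ^ t := by
  have hn : (0:ℝ) < (Fintype.card V : ℝ) := by exact_mod_cast Fintype.card_pos
  have hn1 : (1:ℝ) ≤ (Fintype.card V : ℝ) := by exact_mod_cast Fintype.card_pos
  set n : ℝ := (Fintype.card V : ℝ) with hnd
  induction t with
  | zero =>
    refine ⟨fun A σ => if A = ∅ then ν σ else 0, ?_, ?_, ?_, ?_⟩
    · intro A σ; dsimp only; split_ifs
      · exact hν σ
      · exact le_rfl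
    · intro σ; simp [chainDist]
    · intro A
      by_cases hA : A = ∅
      · subst hA
        intro B hB τ
        have : B = ∅ := Finset.subset_empty.1 hB
        subst this
        simp [margin]
      · simp only [hA, if_false]; exact Bd_zero p A
    · intro w
      have : ∀ A : Finset V, (if w ∈ A then 0 else ∑ σ, if A = ∅ then ν σ else 0) =
          if A = ∅ then (1:ℝ) else 0 := by
        intro A
        by_cases hA : A = ∅
        · subst hA; simp [hν1]
        · simp [hA]
      simp only [this]
      simp
  | succ t ih =>
    obtain ⟨a, ha0, has, hab, ham⟩ := ih
    refine ⟨fun B σ => ∑ A, ∑ v, if insert v A = B then n⁻¹ * Tv v μ (a A) σ else 0, ?_, ?_, ?_, ?_⟩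
    · intro B σ
      refine Finset.sum_nonneg fun A _ => Finset.sum_nonneg fun v _ => ?_
      split_ifs
      · exact mul_nonneg (inv_pos.2 hn).le (Tv_nonneg v μ _ hμ (ha0 A) σ)
      · exact le_rfl
    · intro σ
      rw [chain_step, Finset.sum_comm]
      have h1 : ∀ A : Finset V, ∑ B, ∑ v, (if insert v A = B then n⁻¹ * Tv v μ (a A) σ else 0) =
          ∑ v, n⁻¹ * Tv v μ (a A) σ := by
        intro A
        rw [Finset.sum_comm]
        simp
      simp only [h1]
      unfold Pg
      rw [Finset.sum_comm, Finset.mul_sum]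
      refine Finset.sum_congr rfl fun v _ => ?_
      rw [← Finset.mul_sum]
      congr 1
      unfold Tv Sv
      rw [has, has, ← Finset.mul_sum, ← Finset.sum_div, Finset.sum_add_distrib]
    · intro B
      refine Bd_sum _ _ _ _ fun A _ => Bd_sum _ _ _ _ fun v _ => ?_
      by_cases h : insert v A = B
      · simp only [h, if_true]
        rw [← h]
        exact Bd_smul _ _ _ _ (inv_pos.2 hn).le (Bd_step p hp μ hμ hpm A (a A) (ha0 A) v (hab A))
      · simp only [h, if_false]; exact Bd_zero p B
    · intro w
      have h1 : ∀ B : Finset V, (if w ∈ B then 0 else ∑ σ, ∑ A, ∑ v,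
          if insert v A = B then n⁻¹ * Tv v μ (a A) σ else 0) =
          ∑ A, ∑ v, if insert v A = B then (if w ∈ insert v A then 0 else n⁻¹ * ∑ σ, a A σ) else 0 := by
        intro B
        split_ifs with hw
        · symm
          refine Finset.sum_eq_zero fun A _ => Finset.sum_eq_zero fun v _ => ?_
          by_cases h : insert v A = B
          · simp only [h, hw, if_true]
          · simp [h]
        · rw [Finset.sum_comm]
          refine Finset.sum_congr rfl fun A _ => ?_
          rw [Finset.sum_comm]
          refine Finset.sum_congr rfl fun v _ => ?_
          by_cases h : insert v A = B
          · simp only [h, hw, if_true, if_false]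
            rw [← Finset.mul_sum, sum_Tv _ _ _ hμ]
          · simp [h]
      simp only [h1]
      rw [Finset.sum_comm]
      have h2 : ∀ A : Finset V, ∑ B, ∑ v,
          (if insert v A = B then (if w ∈ insert v A then 0 else n⁻¹ * ∑ σ, a A σ) else 0) =
          (1 - 1 / n) * (if w ∈ A then 0 else ∑ σ, a A σ) := by
        intro A
        rw [Finset.sum_comm]
        simp only [Finset.sum_ite_eq, Finset.mem_univ, if_true]
        by_cases hw : w ∈ A
        · simp [hw]
        · have : ∀ v : V, (if w ∈ insert v A then 0 else n⁻¹ * ∑ σ, a A σ) =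
              n⁻¹ * (∑ σ, a A σ) - (if w = v then n⁻¹ * ∑ σ, a A σ else 0) := by
            intro v
            by_cases hv : w = v
            · simp [hv]
            · simp [hv, hw]
          simp only [this, hw, if_false]
          rw [Finset.sum_sub_distrib, Finset.sum_const, Finset.card_univ, nsmul_eq_mul, ← hnd]
          simp only [Finset.sum_ite_eq, Finset.mem_univ, if_true]
          field_simp
      simp only [h2]
      rw [← Finset.mul_sum, pow_succ, mul_comm]
      refine mul_le_mul_of_nonneg_right (ham w) ?_
      have : 1 / n ≤ 1 := by rw [div_le_one hn]; exact hn1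
      linarith

theorem burn [Nonempty V] (p : V → Bool → ℝ) (hp : ∀ v b, 0 ≤ p v b) (μ : Conf V → ℝ)
    (hμ : ∀ σ, 0 < μ σ) (hpm : ∀ v σ, μ σ ≤ p v (σ v) * Sv v μ σ) (ν : Conf V → ℝ)
    (hν : ∀ σ, 0 ≤ ν σ) (hν1 : ∑ σ, ν σ = 1) (t : ℕ) :
    ∃ g : Conf V → ℝ, (∀ σ, 0 ≤ g σ) ∧ (∀ σ, g σ ≤ chainDist μ ν t σ) ∧
      (∀ σ, g σ ≤ ∏ u, p u (σ u)) ∧ ∑ σ, chainDist μ ν t σ = 1 ∧ ∑ σ, g σ ≤ 1 ∧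
      1 - ∑ σ, g σ ≤ Fintype.card V * Real.exp (-(t / Fintype.card V)) := by
  have hn : (0:ℝ) < (Fintype.card V : ℝ) := by exact_mod_cast Fintype.card_pos
  have hn1 : (1:ℝ) ≤ (Fintype.card V : ℝ) := by exact_mod_cast Fintype.card_pos
  obtain ⟨a, ha0, has, hab, ham⟩ := dec p hp μ hμ hpm ν hν hν1 t
  have hs1 : ∀ t, ∑ σ, chainDist μ ν t σ = 1 := by
    intro t
    induction t with
    | zero => exact hν1
    | succ t ih => rw [chain_step, sum_Pg _ _ hμ, ih]
  have hle : ∀ σ, a Finset.univ σ ≤ chainDist μ ν t σ := by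
    intro σ
    rw [has]
    exact Finset.single_le_sum (f := fun A => a A σ) (fun A _ => ha0 A σ) (Finset.mem_univ _)
  have hm : ∑ σ, a Finset.univ σ ≤ 1 := by
    rw [← hs1 t]; exact Finset.sum_le_sum fun σ _ => hle σ
  refine ⟨a Finset.univ, ha0 _, hle, ?_, hs1 t, hm, ?_⟩
  · intro σ
    have h1 := hab Finset.univ Finset.univ (Finset.Subset.refl _) σ
    have h2 : margin (a Finset.univ) Finset.univ σ = a Finset.univ σ := by
      unfold margin
      have : ∀ τ : Conf V, (∀ v ∈ Finset.univ, τ v = σ v) ↔ τ = σ := by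
        intro τ; simp [funext_iff]
      simp only [this]
      simp
    rw [h2] at h1
    refine h1.trans ?_
    have : 0 ≤ ∏ u, p u (σ u) := Finset.prod_nonneg fun u _ => hp _ _
    nlinarith
  · have h1 : (1:ℝ) = ∑ A, ∑ σ, a A σ := by
      rw [Finset.sum_comm, ← hs1 t]
      exact Finset.sum_congr rfl fun σ _ => has σ
    have h0 : ∀ A, 0 ≤ ∑ σ, a A σ := fun A => Finset.sum_nonneg fun σ _ => ha0 A σ
    have h2 : ∑ A, ∑ σ, a A σ ≤ ∑ A, ((if A = Finset.univ then ∑ σ, a A σ else 0) +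
        ∑ w, if w ∈ A then 0 else ∑ σ, a A σ) := by
      refine Finset.sum_le_sum fun A _ => ?_
      have hnn : ∀ w ∈ (Finset.univ : Finset V), (0:ℝ) ≤ if w ∈ A then 0 else ∑ σ, a A σ := by
        intro w _; split_ifs
        · exact le_rfl
        · exact h0 A
      by_cases hA : A = Finset.univ
      · rw [if_pos hA]
        have := Finset.sum_nonneg hnn
        linarith
      · rw [if_neg hA]
        obtain ⟨w, hw⟩ : ∃ w, w ∉ A := by
          by_contra hcon
          push Not at hcon
          exact hA (Finset.eq_univ_iff_forall.2 hcon)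
        have := Finset.single_le_sum hnn (Finset.mem_univ w)
        rw [if_neg hw] at this
        linarith
    rw [← h1, Finset.sum_add_distrib, Finset.sum_comm (f := fun A w => if w ∈ A then 0 else ∑ σ, a A σ)] at h2
    simp only [Finset.sum_ite_eq', Finset.mem_univ, if_true] at h2
    have h3 := Finset.sum_le_sum (s := Finset.univ) fun w _ => ham w
    rw [Finset.sum_const, Finset.card_univ, nsmul_eq_mul] at h3
    have h4 : (1 - 1 / (Fintype.card V : ℝ)) ^ t ≤ Real.exp (-(t / Fintype.card V)) := by
      have h5 : 1 - 1 / (Fintype.card V : ℝ) ≤ Real.exp (-(1 / (Fintype.card V : ℝ))) := by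
        have := Real.add_one_le_exp (-(1 / (Fintype.card V : ℝ)))
        linarith
      have h6 : 0 ≤ 1 - 1 / (Fintype.card V : ℝ) := by
        have : 1 / (Fintype.card V : ℝ) ≤ 1 := by rw [div_le_one hn]; exact hn1
        linarith
      refine (pow_le_pow_left₀ h6 h5 t).trans ?_
      rw [← Real.exp_nat_mul]
      apply le_of_eq
      congr 1; ring
    have h7 := mul_le_mul_of_nonneg_left h4 hn.le
    linarith

end IsingAux

namespace IsingAux
variable {V : Type} [Fintype V] [DecidableEq V]

def pv (h : V → ℝ) (v : V) (s : Bool) : ℝ :=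
  Real.exp (h v * sg s) / (Real.exp (h v) + Real.exp (-h v))

theorem pv_pos (h : V → ℝ) (v : V) (s : Bool) : 0 < pv h v s := by unfold pv; positivity

theorem lin_bd (M : V → V → ℝ) (h3 : ∀ u, ∑ v, |M u v| ≤ 3) (v : V) (σ : Conf V) :
    |∑ w, M v w * sg (σ w)| ≤ 3 := by
  refine (Finset.abs_sum_le_sum_abs _ _).trans (le_trans (le_of_eq ?_) (h3 v))
  exact Finset.sum_congr rfl fun w _ => by rw [abs_mul, sg_abs, mul_one]

theorem cond_bd (c : ℝ) (hc : 0 < c) (M : V → V → ℝ) (h : V → ℝ) (hM : ∀ a b, M a b = M b a)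
    (hd : ∀ a, M a a = 0) (h3 : ∀ u, ∑ v, |M u v| ≤ 3) (v : V) (σ : Conf V) :
    c * wt M h σ ≤ (Real.exp 6 * pv h v (σ v)) * Sv v (fun σ => c * wt M h σ) σ := by
  obtain ⟨B, hB⟩ : ∃ B, ∀ s : Bool, wt M h (Function.update σ v s) = Real.exp (h v * sg s) *
      Real.exp (B + sg s * ∑ w, M v w * sg (σ w)) := by
    refine ⟨(1/2) * (∑ a, ∑ b, Mz M v a b * sg (σ a) * sg (σ b)) +
      ∑ a, Function.update h v 0 a * sg (σ a), fun s => ?_⟩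
    rw [wt_update M hM hd]
    unfold wt
    congr 2
    simp only [Pi.add_apply, Pi.smul_apply, smul_eq_mul, add_mul, Finset.sum_add_distrib]
    rw [Finset.mul_sum (f := fun w => M v w * sg (σ w))]
    simp only [mul_assoc, add_assoc]
  have hL := abs_le.1 (lin_bd M h3 v σ)
  set L := ∑ w, M v w * sg (σ w)
  have hs : wt M h σ = Real.exp (h v * sg (σ v)) * Real.exp (B + sg (σ v) * L) := by
    rw [← hB, Function.update_eq_self]
  have hup : wt M h σ ≤ Real.exp (h v * sg (σ v)) * Real.exp (B + 3) := by
    rw [hs]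
    refine mul_le_mul_of_nonneg_left (Real.exp_le_exp.2 ?_) (Real.exp_pos _).le
    rcases sg_cases (σ v) with e | e <;> rw [e] <;> linarith
  have hlo : (Real.exp (h v) + Real.exp (-h v)) * Real.exp (B - 3) ≤
      wt M h (Function.update σ v true) + wt M h (Function.update σ v false) := by
    rw [hB, hB, add_mul]
    simp only [sg]
    refine add_le_add ?_ ?_
    · rw [mul_one]
      exact mul_le_mul_of_nonneg_left (Real.exp_le_exp.2 (by linarith)) (Real.exp_pos _).le
    · rw [mul_neg_one]
      exact mul_le_mul_of_nonneg_left (Real.exp_le_exp.2 (by linarith)) (Real.exp_pos _).le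
  have hz : 0 < Real.exp (h v) + Real.exp (-h v) := by positivity
  have e : Real.exp (h v * sg (σ v)) * Real.exp (B + 3) =
      (Real.exp 6 * pv h v (σ v)) * ((Real.exp (h v) + Real.exp (-h v)) * Real.exp (B - 3)) := by
    unfold pv
    have : Real.exp (B + 3) = Real.exp 6 * Real.exp (B - 3) := by
      rw [← Real.exp_add]; congr 1; ring
    rw [this]
    field_simp
  have h6 : 0 ≤ Real.exp 6 * pv h v (σ v) := mul_nonneg (Real.exp_pos _).le (pv_pos _ _ _).le
  have h7 := (hup.trans (le_of_eq e)).trans (mul_le_mul_of_nonneg_left hlo h6)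
  have h8 := mul_le_mul_of_nonneg_left h7 hc.le
  refine h8.trans (le_of_eq ?_)
  unfold Sv
  ring

theorem low_bd (c : ℝ) (hc : 0 < c) (M : V → V → ℝ) (h : V → ℝ) 
    (h3 : ∀ u, ∑ v, |M u v| ≤ 3) (h1 : ∑ σ, c * wt M h σ = 1) (σ : Conf V) :
    ∏ u, pv h u (σ u) ≤ Real.exp (3 * Fintype.card V) * (c * wt M h σ) := by
  have hQ : ∀ σ : Conf V, |(1/2) * (∑ u, ∑ v, M u v * sg (σ u) * sg (σ v))| ≤ 3 / 2 * Fintype.card V := by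
    intro σ
    have : |∑ u, ∑ v, M u v * sg (σ u) * sg (σ v)| ≤ 3 * Fintype.card V := by
      refine (Finset.abs_sum_le_sum_abs _ _).trans ?_
      have : ∀ u ∈ (Finset.univ : Finset V), |∑ v, M u v * sg (σ u) * sg (σ v)| ≤ 3 := by
        intro u _
        refine (Finset.abs_sum_le_sum_abs _ _).trans (le_trans (le_of_eq ?_) (h3 u))
        exact Finset.sum_congr rfl fun w _ => by rw [abs_mul, abs_mul, sg_abs, sg_abs, mul_one, mul_one]
      refine (Finset.sum_le_sum this).trans (le_of_eq ?_)
      rw [Finset.sum_const, Finset.card_univ, nsmul_eq_mul]; ring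
    rw [abs_mul, abs_of_pos (by norm_num : (0:ℝ) < 1/2)]
    linarith
  set n : ℝ := (Fintype.card V : ℝ)
  have hw : ∀ σ : Conf V, wt M h σ = Real.exp ((1/2) * (∑ u, ∑ v, M u v * sg (σ u) * sg (σ v))) *
      ∏ u, Real.exp (h u * sg (σ u)) := by
    intro σ; unfold wt; rw [Real.exp_add, Real.exp_sum]
  have hpp : ∀ σ : Conf V, 0 < ∏ u, Real.exp (h u * sg (σ u)) := fun σ =>
    Finset.prod_pos fun u _ => Real.exp_pos _
  have hlo : ∀ σ : Conf V, Real.exp (-(3/2*n)) * ∏ u, Real.exp (h u * sg (σ u)) ≤ wt M h σ := by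
    intro σ
    rw [hw]
    exact mul_le_mul_of_nonneg_right (Real.exp_le_exp.2 (abs_le.1 (hQ σ)).1) (hpp σ).le
  have hup : ∀ σ : Conf V, wt M h σ ≤ Real.exp (3/2*n) * ∏ u, Real.exp (h u * sg (σ u)) := by
    intro σ
    rw [hw]
    exact mul_le_mul_of_nonneg_right (Real.exp_le_exp.2 (abs_le.1 (hQ σ)).2) (hpp σ).le
  have hZ : ∑ σ : Conf V, ∏ u, Real.exp (h u * sg (σ u)) = ∏ u, (Real.exp (h u) + Real.exp (-h u)) := by
    have := Finset.prod_univ_sum (fun _ : V => (Finset.univ : Finset Bool))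
      (fun u b => Real.exp (h u * sg b))
    rw [Fintype.piFinset_univ] at this
    rw [← this]
    refine Finset.prod_congr rfl fun u _ => ?_
    simp [sg]
  have hZ0 : 0 < ∏ u, (Real.exp (h u) + Real.exp (-h u)) := Finset.prod_pos fun u _ => by positivity
  have h2 : 1 ≤ c * (Real.exp (3/2*n) * ∏ u, (Real.exp (h u) + Real.exp (-h u))) := by
    rw [← h1, ← hZ, Finset.mul_sum, Finset.mul_sum]
    exact Finset.sum_le_sum fun σ _ => mul_le_mul_of_nonneg_left (hup σ) hc.le
  unfold pv
  rw [Finset.prod_div_distrib, div_le_iff₀ hZ0]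
  have e : Real.exp (3 * n) = Real.exp (3/2*n) * Real.exp (3/2*n) := by
    rw [← Real.exp_add]; congr 1; ring
  have e2 : Real.exp (3/2*n) * Real.exp (-(3/2*n)) = 1 := by
    rw [← Real.exp_add]; simp
  rw [e]
  have h5 : ∏ u, Real.exp (h u * sg (σ u)) ≤ Real.exp (3/2*n) * wt M h σ := by
    have := mul_le_mul_of_nonneg_left (hlo σ) (Real.exp_pos (3/2*n)).le
    rwa [← mul_assoc, e2, one_mul] at this
  have h6 := mul_le_mul_of_nonneg_left h2 (mul_pos (Real.exp_pos (3/2*n)) (wt_pos M h σ)).le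
  refine (h5.trans (by linarith)).trans (h6.trans (le_of_eq (by ring)))

theorem mix [Nonempty V] (c : ℝ) (hc : 0 < c) (M : V → V → ℝ) (h : V → ℝ) (hM : ∀ a b, M a b = M b a)
    (hd : ∀ a, M a a = 0) (h3 : ∀ u, ∑ v, |M u v| ≤ 3) (μ : Conf V → ℝ) 
    (hμe : μ = fun σ => c * wt M h σ) (h1 : ∑ σ, μ σ = 1) (C : ℝ) (hC : 0 < C) (hAT : AT μ C)
    (X : Conf V) (ε : ℝ) (hε : 0 < ε) (hε1 : ε < 1) (t0 t1 : ℕ)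
    (ht0 : Fintype.card V * Real.exp (-(t0 / Fintype.card V)) ≤ ε / 4)
    (ht1 : Real.exp (-(t1 / (Fintype.card V * C))) * (10 * Fintype.card V) ≤ ε ^ 2 / 4) :
    tvDist (chainDist μ (fun σ => if σ = X then 1 else 0) (t0 + t1)) μ ≤ ε := by
  have hn1 : (1:ℝ) ≤ (Fintype.card V : ℝ) := by exact_mod_cast Fintype.card_pos
  have hμ : ∀ σ, 0 < μ σ := fun σ => by rw [hμe]; exact mul_pos hc (wt_pos _ _ _)
  obtain ⟨g, hg0, hgl, hgp, hs1, hg1, hq⟩ := burn (fun v s => Real.exp 6 * pv h v s)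
    (fun v b => mul_nonneg (Real.exp_pos _).le (pv_pos _ _ _).le) μ hμ
    (fun v σ => by rw [hμe]; exact cond_bd c hc M h hM hd h3 v σ)
    (fun σ => if σ = X then 1 else 0) (fun σ => by split_ifs <;> simp) (by simp) t0
  rw [chain_iter]
  set ν := chainDist μ (fun σ => if σ = X then 1 else 0) t0
  set n : ℝ := (Fintype.card V : ℝ) with hn
  set q := 1 - ∑ σ, g σ with hqd
  have hq0 : 0 ≤ q := by linarith
  have hqe : q ≤ ε / 4 := hq.trans ht0
  have hgμ : ∀ σ, g σ ≤ Real.exp (9 * n) * μ σ := by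
    intro σ
    refine (hgp σ).trans ?_
    rw [Finset.prod_mul_distrib, Finset.prod_const, Finset.card_univ, ← Real.exp_nat_mul]
    have h2 := low_bd c hc M h h3 (by rw [hμe] at h1; exact h1) σ
    have h4 := mul_le_mul_of_nonneg_left h2 (Real.exp_pos (n * 6)).le
    refine h4.trans (le_of_eq ?_)
    rw [hμe, ← mul_assoc, ← Real.exp_add]
    congr 2; ring
  set η := ε / 4 with hη
  have hη0 : 0 < η := by positivity
  have hη1 : η < 1 := by linarith
  set ρ : Conf V → ℝ := fun σ => (1 - η) * (g σ + q * μ σ) + η * μ σ with hρ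
  have hρ0 : ∀ σ, 0 < ρ σ := by
    intro σ
    have h2 := mul_nonneg (by linarith : 0 ≤ 1 - η) (add_nonneg (hg0 σ) (mul_nonneg hq0 (hμ σ).le))
    have h4 := mul_pos hη0 (hμ σ)
    simp only [hρ]; linarith
  have hρ1 : ∑ σ, ρ σ = 1 := by
    simp only [hρ]
    rw [Finset.sum_add_distrib, ← Finset.mul_sum, ← Finset.mul_sum, Finset.sum_add_distrib,
      ← Finset.mul_sum, h1]
    have : ∑ σ, g σ = 1 - q := by rw [hqd]; ring
    rw [this]; ring
  have hρμ : ∀ σ, ρ σ ≤ Real.exp (10 * n) * μ σ := by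
    intro σ
    have e1 : 2 ≤ Real.exp n := by have := Real.add_one_le_exp n; linarith
    have e2 : 1 ≤ Real.exp (9 * n) := Real.one_le_exp (by linarith)
    have e3 : Real.exp (10 * n) = Real.exp (9 * n) * Real.exp n := by
      rw [← Real.exp_add]; congr 1; ring
    have e4 : Real.exp (9 * n) + 1 ≤ Real.exp (10 * n) := by rw [e3]; nlinarith
    have hq1 : q ≤ 1 := by linarith
    have m0 := hμ σ
    have h2 : g σ + q * μ σ ≤ Real.exp (10 * n) * μ σ := by
      have := hgμ σ
      nlinarith [mul_le_mul_of_nonneg_right e4 m0.le, mul_le_mul_of_nonneg_right hq1 m0.le]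
    have h4 : μ σ ≤ Real.exp (10 * n) * μ σ := by
      have : 1 ≤ Real.exp (10 * n) := by linarith
      nlinarith
    simp only [hρ]
    nlinarith [mul_le_mul_of_nonneg_left h2 (by linarith : 0 ≤ 1 - η),
      mul_le_mul_of_nonneg_left h4 hη0.le]
  have hL : Lf ρ μ ≤ 10 * n := by
    unfold Lf
    rw [hρ1, h1]
    simp only [div_one, Real.log_one, mul_zero, sub_zero]
    have : ∀ σ ∈ (Finset.univ : Finset (Conf V)), ρ σ * Real.log (ρ σ / μ σ) ≤ ρ σ * (10 * n) := by
      intro σ _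
      refine mul_le_mul_of_nonneg_left ?_ (hρ0 σ).le
      rw [Real.log_le_iff_le_exp (div_pos (hρ0 σ) (hμ σ)), div_le_iff₀ (hμ σ)]
      exact hρμ σ
    refine (Finset.sum_le_sum this).trans ?_
    rw [← Finset.sum_mul, hρ1, one_mul]
  obtain ⟨k0, k1, k2⟩ := iter_kl μ ρ hμ hρ0 C hC hAT t1
  have k3 : Lf ((Pg μ)^[t1] ρ) μ ≤ ε ^ 2 / 4 :=
    k2.trans ((mul_le_mul_of_nonneg_left hL (Real.exp_pos _).le).trans ht1)
  have k4 := pinsker _ μ k0 hμ (k1.trans hρ1) h1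
  have k5 : ∑ σ, |(Pg μ)^[t1] ρ σ - μ σ| ≤ ε := by
    refine abs_le_of_sq_le_sq' ?_ hε.le |>.2
    linarith
  have k6 := iter_l1 μ ν ρ hμ t1
  have k7 : ∑ σ, |ν σ - ρ σ| ≤ ε := by
    have : ∀ σ ∈ (Finset.univ : Finset (Conf V)), |ν σ - ρ σ| ≤ (ν σ - g σ) + q * μ σ + (η * (g σ + q * μ σ) + η * μ σ) := by
      intro σ _
      have a1 := hgl σ
      have a2 := mul_nonneg hq0 (hμ σ).le
      have a3 := mul_nonneg hη0.le (add_nonneg (hg0 σ) a2)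
      have a4 := mul_nonneg hη0.le (hμ σ).le
      simp only [hρ]
      rw [abs_le]; constructor <;> nlinarith
    refine (Finset.sum_le_sum this).trans ?_
    simp only [Finset.sum_add_distrib, Finset.sum_sub_distrib, ← Finset.mul_sum]
    rw [h1, hs1]
    have : ∑ σ, g σ = 1 - q := by rw [hqd]; ring
    rw [this]
    linarith
  have k8 : ∑ σ, |(Pg μ)^[t1] ν σ - μ σ| ≤
      ∑ σ, |(Pg μ)^[t1] ν σ - (Pg μ)^[t1] ρ σ| + ∑ σ, |(Pg μ)^[t1] ρ σ - μ σ| := by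
    rw [← Finset.sum_add_distrib]
    exact Finset.sum_le_sum fun σ _ => abs_sub_le _ _ _
  unfold tvDist
  linarith

theorem numer (n ε δ r : ℝ) (hn : 4 ≤ n) (hε : 0 < ε) (hε1 : ε < 1) (hδ : 0 < δ) (hδ1 : δ < 1)
    (hr : 1 ≤ r) : ∃ t0 t1 : ℕ, n * Real.exp (-(t0 / n)) ≤ ε / 4 ∧
      Real.exp (-(t1 / (n * Real.exp (148 / δ)))) * (10 * n) ≤ ε ^ 2 / 4 ∧
      ((t0 + t1 : ℕ) : ℝ) ≤ Real.exp (152 / δ) * r * n * (Real.log (n / ε) + Real.log (Real.log (2 * r))) := by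
  set C := Real.exp (148 / δ) with hC
  have hC1 : 1 ≤ C := Real.one_le_exp (by positivity)
  set L := Real.log (n / ε) with hL
  have l2 := Real.log_two_gt_d9
  have hnε : 4 ≤ n / ε := by rw [le_div_iff₀ hε]; nlinarith
  have hl4 : Real.log 4 = 2 * Real.log 2 := by
    rw [show (4:ℝ) = 2 ^ 2 by norm_num, Real.log_pow]; norm_num
  have hL4 : Real.log 4 ≤ L := Real.log_le_log (by norm_num) hnε
  have hL1 : 1.38 ≤ L := by rw [hl4] at hL4; linarith
  have a0 : Real.log (4 * n / ε) ≤ 2 * L := by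
    rw [mul_div_assoc, Real.log_mul (by norm_num) (by positivity)]; linarith
  have a1 : Real.log (40 * n / ε ^ 2) ≤ 5 * L := by
    have : Real.log (40 * n / ε ^ 2) ≤ Real.log ((n / ε) ^ 5) := by
      refine Real.log_le_log (by positivity) ?_
      rw [div_pow, div_le_div_iff₀ (by positivity) (by positivity)]
      have e1 : ε ^ 5 ≤ ε ^ 2 := pow_le_pow_of_le_one hε.le hε1.le (by norm_num)
      have e2 : (4:ℝ) ^ 4 ≤ n ^ 4 := pow_le_pow_left₀ (by norm_num) hn 4
      have e3 : 40 * n ≤ n ^ 5 := by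
        have : n ^ 5 = n ^ 4 * n := by ring
        rw [this]; nlinarith
      exact mul_le_mul e3 e1 (by positivity) (by positivity)
    rwa [Real.log_pow] at this
  have p0 : 0 ≤ Real.log (4 * n / ε) := Real.log_nonneg (by rw [mul_div_assoc]; linarith)
  have p1 : 0 ≤ Real.log (40 * n / ε ^ 2) := by
    refine Real.log_nonneg ?_
    rw [le_div_iff₀ (by positivity)]
    have : ε ^ 2 ≤ 1 := pow_le_one₀ hε.le hε1.le
    linarith
  have hn0 : 0 < n := by linarith
  refine ⟨⌈n * Real.log (4 * n / ε)⌉₊, ⌈n * C * Real.log (40 * n / ε ^ 2)⌉₊, ?_, ?_, ?_⟩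
  · have h1 := Nat.le_ceil (n * Real.log (4 * n / ε))
    have h2 : Real.log (4 * n / ε) ≤ (⌈n * Real.log (4 * n / ε)⌉₊ : ℝ) / n := by
      rw [le_div_iff₀ hn0]; linarith
    have h3 := Real.exp_le_exp.2 (neg_le_neg h2)
    rw [Real.exp_neg (Real.log _), Real.exp_log (by positivity)] at h3
    refine (mul_le_mul_of_nonneg_left h3 hn0.le).trans (le_of_eq ?_)
    field_simp
  · have h1 := Nat.le_ceil (n * C * Real.log (40 * n / ε ^ 2))
    have h2 : Real.log (40 * n / ε ^ 2) ≤ (⌈n * C * Real.log (40 * n / ε ^ 2)⌉₊ : ℝ) / (n * C) := by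
      rw [le_div_iff₀ (by positivity)]; linarith
    have h3 := Real.exp_le_exp.2 (neg_le_neg h2)
    rw [Real.exp_neg (Real.log _), Real.exp_log (by positivity)] at h3
    refine (mul_le_mul_of_nonneg_right h3 (by positivity)).trans (le_of_eq ?_)
    field_simp
    norm_num
  · have h1 := (Nat.ceil_lt_add_one (mul_nonneg hn0.le p0)).le
    have h2 := (Nat.ceil_lt_add_one (mul_nonneg (by positivity : 0 ≤ n * C) p1)).le
    have hnL : 1 ≤ n * L := by nlinarith
    have hLpos : 0 < L := by linarith
    have t : (⌈n * Real.log (4 * n / ε)⌉₊ : ℝ) + ⌈n * C * Real.log (40 * n / ε ^ 2)⌉₊ ≤ 9 * (C * (n * L)) := by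
      have b1 := mul_le_mul_of_nonneg_left a0 hn0.le
      have b2 := mul_le_mul_of_nonneg_left a1 (by positivity : 0 ≤ n * C)
      have b3 : n * L ≤ C * (n * L) := by nlinarith
      nlinarith
    have hll : -(L / 2) ≤ Real.log (Real.log (2 * r)) := by
      have c1 : Real.log 2 ≤ Real.log (2 * r) := Real.log_le_log (by norm_num) (by linarith)
      have c2 : Real.log (Real.log 2) ≤ Real.log (Real.log (2 * r)) :=
        Real.log_le_log (by linarith) c1
      have c3 := Real.one_sub_inv_le_log_of_pos (by linarith : 0 < Real.log 2)
      have c4 : (Real.log 2)⁻¹ ≤ 1.5 := by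
        rw [inv_le_comm₀ (by linarith) (by norm_num)]; norm_num; linarith
      norm_num at c4 hL1
      linarith
    have h16 : 18 * C ≤ Real.exp (152 / δ) := by
      have e1 : Real.exp (152 / δ) = Real.exp (4 / δ) * C := by
        rw [hC, ← Real.exp_add]; congr 1; ring
      have e2 : Real.exp 4 ≤ Real.exp (4 / δ) := by
        refine Real.exp_le_exp.2 ?_
        rw [le_div_iff₀ hδ]; linarith
      have e3 : 18 ≤ Real.exp 4 := by
        have g := Real.exp_one_gt_d9
        have : Real.exp 4 = Real.exp 1 ^ 4 := by rw [← Real.exp_nat_mul]; norm_num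
        rw [this]
        have : (2.7:ℝ) ^ 4 ≤ Real.exp 1 ^ 4 := pow_le_pow_left₀ (by norm_num) (by linarith) 4
        norm_num at this
        linarith
      rw [e1]
      nlinarith
    push_cast
    calc _ ≤ 9 * (C * (n * L)) := t
      _ = 18 * C * 1 * n * (L / 2) := by ring
      _ ≤ Real.exp (152 / δ) * r * n * (L / 2) := by gcongr
      _ ≤ _ := by
        refine mul_le_mul_of_nonneg_left (by linarith) (by positivity)

end IsingAux

open IsingAux
/-- Optimal mixing of Glauber dynamics for near-critical Ising models:
there is a universal constant `c > 0` such that for every `δ ∈ (0,1)`, with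
`C_δ = exp(c/δ)`, every Ising model with max degree `Δ ≥ 3`,
`(Δ−2+δ)/(Δ−δ) ≤ β ≤ (Δ−δ)/(Δ−2+δ)` and positive fields `λ` satisfies
`T_mix(ε) ≤ C_δ (λ_max/λ_min) n (log(n/ε) + log log(2λ_max/λ_min))`. -/
theorem ising_optimal_mixing :
    ∃ c : ℝ, 0 < c ∧
      ∀ (V : Type) [Fintype V] [DecidableEq V] [Nonempty V]
        (G : SimpleGraph V) [DecidableRel G.Adj] (δ β : ℝ) (lam : V → ℝ),
        0 < δ → δ < 1 → 3 ≤ G.maxDegree →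
        ((G.maxDegree : ℝ) - 2 + δ) / ((G.maxDegree : ℝ) - δ) ≤ β →
        β ≤ ((G.maxDegree : ℝ) - δ) / ((G.maxDegree : ℝ) - 2 + δ) →
        (∀ v, 0 < lam v) →
        ∀ ε : ℝ, 0 < ε → ε < 1 →
        ∀ X₀ : Conf V, 0 < isingGibbs G β lam X₀ →
        ∃ t : ℕ,
          (t : ℝ) ≤ Real.exp (c / δ) *
              ((Finset.univ.sup' Finset.univ_nonempty lam) /
                (Finset.univ.inf' Finset.univ_nonempty lam)) *
              (Fintype.card V) *
              (Real.log ((Fintype.card V : ℝ) / ε) +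
                Real.log (Real.log (2 * (Finset.univ.sup' Finset.univ_nonempty lam) /
                  (Finset.univ.inf' Finset.univ_nonempty lam)))) ∧
          tvDist (chainDist (isingGibbs G β lam) (fun σ => if σ = X₀ then 1 else 0) t)
              (isingGibbs G β lam) ≤ ε := by
  refine ⟨152, by norm_num, ?_⟩
  intro V _ _ _ G _ δ β lam hδ hδ1 hΔ hb1 hb2 hl ε hε hε1 X₀ _
  obtain ⟨⟨c, hc, M, h, hM, hd, h3, hμ⟩, h1, hAT⟩ := model G δ β lam hδ hδ1 hΔ hb1 hb2 hl
  have hn : (4:ℝ) ≤ (Fintype.card V : ℝ) := by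
    have := G.maxDegree_lt_card_verts
    have : 4 ≤ Fintype.card V := by omega
    exact_mod_cast this
  obtain ⟨v⟩ := (inferInstance : Nonempty V)
  have hinf : 0 < Finset.univ.inf' Finset.univ_nonempty lam :=
    (Finset.lt_inf'_iff _).2 fun i _ => hl i
  have hr : 1 ≤ (Finset.univ.sup' Finset.univ_nonempty lam) /
      (Finset.univ.inf' Finset.univ_nonempty lam) := by
    rw [le_div_iff₀ hinf, one_mul]
    exact (Finset.inf'_le lam (Finset.mem_univ v)).trans (Finset.le_sup' lam (Finset.mem_univ v))
  obtain ⟨t0, t1, ht0, ht1, ht⟩ := numer _ ε δ _ hn hε hε1 hδ hδ1 hr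
  refine ⟨t0 + t1, ?_, ?_⟩
  · rw [mul_div_assoc 2]
    exact ht
  · exact mix c hc M h hM hd h3 _ hμ h1 _ (Real.exp_pos _) hAT X₀ ε hε hε1 t0 t1 ht0 ht1
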